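/- arXiv:math/0112077 — 10 statements merged into one kernel-verified Lean document; each statement's English description precedes it below -/
import Mathlib

section
/- For integers p ≥ 1 and n, the sawtooth function has the discrete Fourier expansion ((n/p)) = (i/(2p)) Σ_{k=1}^{p-1} cot(πk/p) e^{2πikn/p}. -/
open Real Finset
open scoped Classical

/-- The sawtooth function `((x))`: `{x} - 1/2` if `x` is not an integer, `0` otherwise. -/
noncomputable def sawtooth (x : ℝ) : ℝ :=
  if ∃ n : ℤ, x = n then 0 else Int.fract x - 1/2

lemma saw_val (p : ℕ) (hp : 1 ≤ p) (n : ℤ) :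
    sawtooth ((n : ℝ) / p) = if (p : ℤ) ∣ n then 0 else ((n % p : ℤ) : ℝ) / p - 1 / 2 := by
  have hp0 : (p : ℝ) ≠ 0 := by positivity
  unfold sawtooth
  have h1 : (∃ m : ℤ, (n : ℝ) / p = m) ↔ (p : ℤ) ∣ n := by
    constructor
    · rintro ⟨m, hm⟩
      refine ⟨m, ?_⟩
      rw [div_eq_iff hp0] at hm
      rw [mul_comm]
      exact_mod_cast hm
    · rintro ⟨m, rfl⟩
      refine ⟨m, ?_⟩
      push_cast
      field_simp
  simp only [h1]
  split_ifs with h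
  · rfl
  · congr 1
    rw [Int.fract_eq_iff]
    have hpz : (0 : ℤ) < p := by omega
    have a1 := Int.emod_nonneg n hpz.ne'
    have a2 := Int.emod_lt_of_pos n hpz
    refine ⟨div_nonneg (by exact_mod_cast a1) (by positivity), ?_, n / p, ?_⟩
    · rw [div_lt_one (by positivity)]
      exact_mod_cast a2
    · have e : (n : ℝ) = ((n % p : ℤ) : ℝ) + p * ((n / p : ℤ) : ℝ) := by
        exact_mod_cast (Int.emod_add_mul_ediv n p).symm
      field_simp
      linarith

lemma saw_diff (p : ℕ) (hp : 1 ≤ p) (n : ℤ) :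
    sawtooth (((n + 1 : ℤ) : ℝ) / p) - sawtooth ((n : ℝ) / p) =
      1 / p - ((if (p : ℤ) ∣ n then 1 else 0) + (if (p : ℤ) ∣ n + 1 then 1 else 0)) / 2 := by
  have hp0 : (p : ℝ) ≠ 0 := by positivity
  rw [saw_val p hp, saw_val p hp]
  have hpz : (0 : ℤ) < p := by omega
  have a1 := Int.emod_nonneg n hpz.ne'
  have a2 := Int.emod_lt_of_pos n hpz
  have hs : (n + 1) % p = (n % p + 1) % p := by simp
  by_cases h2 : (p : ℤ) ∣ n + 1
  · have h2' : (n % p + 1) % p = 0 := by rw [← hs]; exact Int.emod_eq_zero_of_dvd h2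
    have h3 : n % p + 1 = p := by
      have := Int.le_of_dvd (by omega) (Int.dvd_of_emod_eq_zero h2')
      omega
    by_cases h1 : (p : ℤ) ∣ n
    · have : n % p = 0 := Int.emod_eq_zero_of_dvd h1
      have : p = 1 := by omega
      subst this
      simp
    · have h4 : ((n % p : ℤ) : ℝ) = p - 1 := by
        have : n % p = (p : ℤ) - 1 := by omega
        rw [this]; push_cast; ring
      simp only [h1, h2, if_true, if_false, h4]
      field_simp
      ring
  · have h3 : (n + 1) % p = n % p + 1 := by
      rw [hs]
      apply Int.emod_eq_of_lt (by omega)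
      by_contra hc
      have : n % p + 1 = p := by omega
      rw [this, Int.emod_self] at hs
      exact h2 (Int.dvd_of_emod_eq_zero hs)
    by_cases h1 : (p : ℤ) ∣ n
    · have : n % p = 0 := Int.emod_eq_zero_of_dvd h1
      simp only [h1, h2, if_true, if_false, h3, this]
      push_cast
      ring
    · simp only [h1, h2, if_false, h3]
      push_cast
      ring

lemma geo (p : ℕ) (hp : 1 ≤ p) (n : ℤ) :
    ∑ k ∈ Finset.Icc 1 (p - 1), Complex.exp (2 * π * Complex.I * k * n / p) =
      (if (p : ℤ) ∣ n then (p : ℂ) else 0) - 1 := by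
  have hp0 : p ≠ 0 := by omega
  have hw := Complex.isPrimitiveRoot_exp p hp0
  set w := Complex.exp (2 * π * Complex.I / p) with hwd
  have ht : ∀ k : ℕ, Complex.exp (2 * π * Complex.I * k * n / p) = (w ^ n) ^ k := by
    intro k
    rw [hwd, ← Complex.exp_int_mul, ← Complex.exp_nat_mul]
    congr 1
    ring
  have hsplit : ∑ k ∈ Finset.range p, (w ^ n) ^ k =
      1 + ∑ k ∈ Finset.Icc 1 (p - 1), (w ^ n) ^ k := by
    have : Finset.range p = insert 0 (Finset.Icc 1 (p - 1)) := by
      ext x; simp; omega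
    rw [this, Finset.sum_insert (by simp)]
    simp
  rw [Finset.sum_congr rfl (fun k _ => ht k), eq_sub_iff_add_eq, add_comm, ← hsplit]
  split_ifs with h
  · rw [(hw.zpow_eq_one_iff_dvd n).2 h]
    simp
  · have h1 : w ^ n ≠ 1 := fun h' => h ((hw.zpow_eq_one_iff_dvd n).1 h')
    rw [geom_sum_eq h1]
    have : (w ^ n) ^ p = 1 := by
      rw [← zpow_natCast, ← zpow_mul, mul_comm, zpow_mul, zpow_natCast, hw.pow_eq_one, one_zpow]
    rw [this]
    simp

lemma term_diff (p : ℕ) (hp : 1 ≤ p) (n : ℤ) (k : ℕ) (hk : k ∈ Finset.Icc 1 (p - 1)) :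
    Complex.cot ((π : ℂ) * k / p) * Complex.exp (2 * π * Complex.I * k * (n + 1 : ℤ) / p) -
    Complex.cot ((π : ℂ) * k / p) * Complex.exp (2 * π * Complex.I * k * n / p) =
    Complex.I * (Complex.exp (2 * π * Complex.I * k * (n + 1 : ℤ) / p) +
      Complex.exp (2 * π * Complex.I * k * n / p)) := by
  have hp0 : p ≠ 0 := by omega
  rw [Finset.mem_Icc] at hk
  have hw := Complex.isPrimitiveRoot_exp p hp0
  have h1 := hw.pow_ne_one_of_pos_of_lt (l := k) (by omega) (by omega)
  rw [← Complex.exp_nat_mul] at h1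
  rw [Complex.cot_eq_exp_ratio]
  have e1 : 2 * Complex.I * ((π : ℂ) * k / p) = k * (2 * π * Complex.I / p) := by ring
  have e2 : 2 * π * Complex.I * k * (n + 1 : ℤ) / p =
    2 * π * Complex.I * k * n / p + k * (2 * π * Complex.I / p) := by push_cast; ring
  rw [e1, e2, Complex.exp_add]
  generalize Complex.exp (k * (2 * π * Complex.I / p)) = z at *
  have h2 : 1 - z ≠ 0 := sub_ne_zero.2 (Ne.symm h1)
  have hI := Complex.I_ne_zero
  have e3 : (z + 1) / (Complex.I * (1 - z)) = Complex.I * (z + 1) / (z - 1) := by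
    have h3 : z - 1 ≠ 0 := sub_ne_zero.2 h1
    rw [div_eq_div_iff (mul_ne_zero hI h2) h3]
    linear_combination (-(z + 1) * (1 - z)) * Complex.I_mul_I
  have h3 : z - 1 ≠ 0 := sub_ne_zero.2 h1
  rw [e3]
  field_simp

lemma base (p : ℕ) (hp : 1 ≤ p) :
    ∑ k ∈ Finset.Icc 1 (p - 1), Complex.cot ((π : ℂ) * k / p) = 0 := by
  have hp0 : (p : ℂ) ≠ 0 := by exact_mod_cast (by omega : p ≠ 0)
  have h : ∑ k ∈ Finset.Icc 1 (p - 1), Complex.cot ((π : ℂ) * k / p) =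
      ∑ k ∈ Finset.Icc 1 (p - 1), - Complex.cot ((π : ℂ) * k / p) := by
    refine Finset.sum_bij' (fun k _ => p - k) (fun k _ => p - k) ?_ ?_ ?_ ?_ ?_
    · intro k hk; simp only [Finset.mem_Icc] at *; omega
    · intro k hk; simp only [Finset.mem_Icc] at *; omega
    · intro k hk; simp only [Finset.mem_Icc] at *; omega
    · intro k hk; simp only [Finset.mem_Icc] at *; omega
    · intro k hk
      simp only [Finset.mem_Icc] at hk
      rw [Nat.cast_sub (by omega)]
      have : (π : ℂ) * ((p : ℂ) - k) / p = π - π * k / p := by field_simp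
      rw [this, Complex.cot, Complex.cot, Complex.cos_pi_sub, Complex.sin_pi_sub]
      ring
  rw [Finset.sum_neg_distrib] at h
  exact self_eq_neg.1 h

lemma rhs_diff (p : ℕ) (hp : 1 ≤ p) (n : ℤ) :
    Complex.I / (2 * p) * ∑ k ∈ Finset.Icc 1 (p - 1),
      Complex.cot ((π : ℂ) * k / p) * Complex.exp (2 * π * Complex.I * k * (n + 1 : ℤ) / p) -
    Complex.I / (2 * p) * ∑ k ∈ Finset.Icc 1 (p - 1),
      Complex.cot ((π : ℂ) * k / p) * Complex.exp (2 * π * Complex.I * k * n / p) =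
    (sawtooth (((n + 1 : ℤ) : ℝ) / p) : ℂ) - (sawtooth ((n : ℝ) / p) : ℂ) := by
  have hp0 : (p : ℂ) ≠ 0 := by exact_mod_cast (by omega : p ≠ 0)
  rw [← Complex.ofReal_sub, saw_diff p hp, ← mul_sub, ← Finset.sum_sub_distrib,
    Finset.sum_congr rfl (term_diff p hp n), ← Finset.mul_sum, Finset.sum_add_distrib,
    geo p hp, geo p hp, ← mul_assoc]
  have : Complex.I / (2 * p) * Complex.I = -1 / (2 * p) := by
    rw [div_mul_eq_mul_div, Complex.I_mul_I]
  rw [this]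
  split_ifs <;> push_cast <;> field_simp <;> ring

/-- Discrete Fourier expansion of the sawtooth function:
`((n/p)) = (i/(2p)) Σ_{k=1}^{p-1} cot(πk/p) e^{2πikn/p}`. -/
theorem sawtooth_fourier (p : ℕ) (hp : 1 ≤ p) (n : ℤ) :
    (sawtooth ((n : ℝ) / p) : ℂ) =
      Complex.I / (2 * p) *
        ∑ k ∈ Finset.Icc 1 (p - 1),
          Complex.cot ((π : ℂ) * k / p) * Complex.exp (2 * π * Complex.I * k * n / p) := by
  induction n using Int.induction_on with
  | zero =>
    have h := base p hp
    have h0 : sawtooth (((0 : ℤ) : ℝ) / p) = 0 := by rw [saw_val p hp]; simp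
    rw [h0]
    simp [h]
  | succ i ih =>
    have h := rhs_diff p hp (i : ℤ)
    rw [← ih] at h
    exact (sub_left_inj.1 h).symm
  | pred i ih =>
    have h := rhs_diff p hp (-(i : ℤ) - 1)
    rw [sub_add_cancel, ← ih] at h
    exact (sub_right_inj.1 h).symm
end

section
/- If a and b are relatively prime positive integers, then the Dedekind sum has the cotangent representation s(a,b) = (1/(4b)) Σ_{k=1}^{b-1} cot(πka/b) cot(πk/b). -/
open Real Finset
open scoped Classical

/-- The Dedekind sum `s(a,b) = Σ_{k mod b} ((ka/b)) ((k/b))`. -/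
noncomputable def dedekindSum (a b : ℕ) : ℝ :=
  ∑ k ∈ Finset.range b, sawtooth (k * a / b) * sawtooth ((k : ℝ) / b)

lemma sawtooth_nat_div (b : ℕ) (hb : 0 < b) (j : ℕ) (hj : j < b) :
    sawtooth ((j : ℝ) / b) = (j : ℝ) / b - 1 / 2 + if j = 0 then 1 / 2 else 0 := by
  have hb' : (0 : ℝ) < b := by exact_mod_cast hb
  have h1 : (j : ℝ) / b < 1 := by
    rw [div_lt_one hb']; exact_mod_cast hj
  have h0 : (0 : ℝ) ≤ (j : ℝ) / b := by positivity
  unfold sawtooth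
  by_cases h : j = 0
  · subst h
    rw [if_pos ⟨0, by simp⟩]; simp
  · have hp : (0 : ℝ) < (j : ℝ) / b := by
      have : (0 : ℝ) < j := by exact_mod_cast Nat.pos_of_ne_zero h
      positivity
    rw [if_neg, if_neg h, Int.fract_eq_self.2 ⟨h0, h1⟩]
    · ring
    · rintro ⟨n, hn⟩
      rw [hn] at h1 hp
      have h1' : n < 1 := by exact_mod_cast h1
      have h2' : 0 < n := by exact_mod_cast hp
      omega

lemma sawtooth_add_nat (x : ℝ) (n : ℕ) : sawtooth (x + n) = sawtooth x := by
  unfold sawtooth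
  have : (∃ m : ℤ, x + n = m) ↔ ∃ m : ℤ, x = m := by
    constructor
    · rintro ⟨m, hm⟩
      exact ⟨m - n, by push_cast; linarith⟩
    · rintro ⟨m, hm⟩
      exact ⟨m + n, by push_cast; linarith⟩
  simp only [this, Int.fract_add_natCast]

lemma sawtooth_mod (b : ℕ) (hb : 0 < b) (n : ℕ) :
    sawtooth ((n : ℝ) / b) = sawtooth (((n % b : ℕ) : ℝ) / b) := by
  have hb' : (b : ℝ) ≠ 0 := by exact_mod_cast hb.ne'
  rw [← sawtooth_add_nat (((n % b : ℕ) : ℝ) / b) (n / b)]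
  congr 1
  have : (n : ℝ) = ((n % b : ℕ) : ℝ) + b * ((n / b : ℕ) : ℝ) := by
    exact_mod_cast (Nat.mod_add_div n b).symm
  field_simp
  linarith

lemma sum_mul_pow_aux (z : ℂ) (n : ℕ) :
    (z - 1) ^ 2 * ∑ j ∈ Finset.range n, (j : ℂ) * z ^ j
      = n * z ^ n * (z - 1) - z * (z ^ n - 1) := by
  induction n with
  | zero => simp
  | succ n ih => rw [Finset.sum_range_succ, mul_add, ih]; push_cast; ring

lemma sum_saw (b : ℕ) (hb : 0 < b) (z : ℂ) (hz : z ^ b = 1) :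
    ∑ j ∈ Finset.range b, (sawtooth ((j : ℝ) / b) : ℂ) * z ^ j = (z + 1) / (2 * (z - 1)) := by
  have hb' : (b : ℂ) ≠ 0 := by exact_mod_cast hb.ne'
  have h1 : ∑ j ∈ Finset.range b, (sawtooth ((j : ℝ) / b) : ℂ) * z ^ j
      = (1 / b) * ∑ j ∈ Finset.range b, (j : ℂ) * z ^ j
        - 1 / 2 * ∑ j ∈ Finset.range b, z ^ j + 1 / 2 := by
    have : ∑ j ∈ Finset.range b, (if j = 0 then (1 / 2 : ℂ) else 0) = 1 / 2 := by
      rw [Finset.sum_ite_eq' (Finset.range b) 0]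
      simp [hb]
    rw [Finset.mul_sum, Finset.mul_sum, ← Finset.sum_sub_distrib]
    conv_rhs => rw [← this]
    rw [← Finset.sum_add_distrib, this]
    refine Finset.sum_congr rfl fun j hj => ?_
    rw [sawtooth_nat_div b hb j (Finset.mem_range.1 hj)]
    by_cases h : j = 0
    · subst h; simp
    · simp [h]; ring
  rw [h1]
  by_cases h : z = 1
  · subst h
    have h2 : ∑ j ∈ Finset.range b, (j : ℂ) = b * (b - 1) / 2 := by
      clear h1 hz hb hb'
      induction b with
      | zero => simp
      | succ n ih => rw [Finset.sum_range_succ, ih]; push_cast; ring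
    simp only [one_pow, mul_one, h2]
    simp
    field_simp
    ring
  · have hz1 : z - 1 ≠ 0 := sub_ne_zero.2 h
    have h3 := sum_mul_pow_aux z b
    rw [hz] at h3
    have h4 : ∑ j ∈ Finset.range b, (j : ℂ) * z ^ j = b / (z - 1) := by
      rw [eq_div_iff hz1]
      apply mul_left_cancel₀ hz1
      linear_combination h3
    rw [h4, geom_sum_eq h, hz]
    field_simp
    ring

lemma cot_char (b : ℕ) [NeZero b] (n : ℕ) :
    ((Real.cot (π * n / b) : ℝ) : ℂ) = (ZMod.stdAddChar (n : ZMod b) + 1)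
      / (Complex.I * (1 - ZMod.stdAddChar (n : ZMod b))) := by
  have h : ZMod.stdAddChar (n : ZMod b) = Complex.exp (2 * π * Complex.I * n / b) := by
    have := ZMod.stdAddChar_coe (N := b) (n : ℤ)
    push_cast at this
    exact this
  rw [Complex.ofReal_cot, Complex.cot_eq_exp_ratio, h]
  have : 2 * Complex.I * ((π * n / b : ℝ) : ℂ) = 2 * π * Complex.I * n / b := by
    push_cast; ring
  rw [this]

lemma sum_zmod_range (b : ℕ) [NeZero b] (f : ZMod b → ℂ) :
    ∑ x, f x = ∑ j ∈ Finset.range b, f (j : ZMod b) := by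
  symm
  refine Finset.sum_bij' (fun (j : ℕ) _ => (j : ZMod b)) (fun x _ => x.val) ?_ ?_ ?_ ?_ ?_
  · simp
  · intro x _; simpa using ZMod.val_lt x
  · intro j hj; exact ZMod.val_cast_of_lt (Finset.mem_range.1 hj)
  · intro x _; simp
  · simp

lemma saw_hat (b : ℕ) [NeZero b] (k : ZMod b) :
    ∑ x : ZMod b, (sawtooth ((x.val : ℝ) / b) : ℂ) * ZMod.stdAddChar (x * k)
      = (ZMod.stdAddChar k + 1) / (2 * (ZMod.stdAddChar k - 1)) := by
  rw [sum_zmod_range, ← sum_saw b (NeZero.pos b)]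
  · refine Finset.sum_congr rfl fun j hj => ?_
    rw [ZMod.val_cast_of_lt (Finset.mem_range.1 hj), ← nsmul_eq_mul, AddChar.map_nsmul_eq_pow]
  · rw [← AddChar.map_nsmul_eq_pow]; simp

lemma frac_neg (z : ℂ) (hz : z ≠ 0) :
    (z⁻¹ + 1) / (2 * (z⁻¹ - 1)) = - ((z + 1) / (2 * (z - 1))) := by
  by_cases h : z = 1
  · subst h; simp
  · have h1 : z - 1 ≠ 0 := sub_ne_zero.2 h
    have h2 : z⁻¹ - 1 ≠ 0 := by
      rw [sub_ne_zero]; simpa using h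
    have h3 : 1 - z ≠ 0 := sub_ne_zero.2 (Ne.symm h)
    rw [← neg_div, div_eq_div_iff (by simpa using h2) (by simpa using h1)]
    field_simp
    ring

lemma cot_mul (z w : ℂ) : (z + 1) / (Complex.I * (1 - z)) * ((w + 1) / (Complex.I * (1 - w)))
    = 4 * ((z + 1) / (2 * (z - 1)) * (- ((w + 1) / (2 * (w - 1))))) := by
  have e : ∀ u : ℂ, (u + 1) / (Complex.I * (1 - u)) = Complex.I * 2 * ((u + 1) / (2 * (u - 1))) := by
    intro u
    by_cases h : u = 1
    · subst h; simp
    · have h1 : u - 1 ≠ 0 := sub_ne_zero.2 h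
      have h3 : 1 - u ≠ 0 := sub_ne_zero.2 (Ne.symm h)
      field_simp
      rw [Complex.I_sq]
      ring
  rw [e, e]
  linear_combination (4 * ((z + 1) / (2 * (z - 1)) * ((w + 1) / (2 * (w - 1))))) * Complex.I_sq

lemma parseval_aux (b : ℕ) [NeZero b] (a : ZMod b) (S : ZMod b → ℂ) :
    ∑ k : ZMod b, (∑ x, S x * ZMod.stdAddChar (x * (k * a))) *
      (∑ y, S y * ZMod.stdAddChar (y * (-k))) = b * ∑ x, S (x * a) * S x := by
  simp_rw [Finset.sum_mul_sum]
  rw [Finset.sum_comm, Finset.mul_sum]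
  refine Finset.sum_congr rfl fun x _ => ?_
  rw [Finset.sum_comm]
  have : ∀ y, ∑ k : ZMod b, S x * ZMod.stdAddChar (x * (k * a)) *
      (S y * ZMod.stdAddChar (y * (-k))) = if x * a = y then b * (S y * S x) else 0 := by
    intro y
    have h := AddChar.sum_mulShift (x * a - y) (ZMod.isPrimitive_stdAddChar b)
    rw [ZMod.card] at h
    have h2 : ∑ k : ZMod b, S x * ZMod.stdAddChar (x * (k * a)) *
      (S y * ZMod.stdAddChar (y * (-k)))
       = S x * S y * ∑ k : ZMod b, ZMod.stdAddChar (k * (x * a - y)) := by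
      rw [Finset.mul_sum]
      refine Finset.sum_congr rfl fun k _ => ?_
      have : k * (x * a - y) = x * (k * a) + y * (-k) := by ring
      rw [this, AddChar.map_add_eq_mul]
      ring
    rw [h2, h]
    by_cases hxy : x * a = y
    · simp [hxy]; ring
    · simp [hxy, sub_eq_zero]
  simp_rw [this]
  simp

/-- Cotangent representation of the Dedekind sum:
`s(a,b) = (1/(4b)) Σ_{k=1}^{b-1} cot(πka/b) cot(πk/b)` for coprime `a, b`. -/
theorem dedekindSum_eq_cot (a b : ℕ) (ha : 0 < a) (hb : 0 < b) (hab : Nat.Coprime a b) :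
    dedekindSum a b =
      1 / (4 * b) * ∑ k ∈ Finset.Icc 1 (b - 1), Real.cot (π * k * a / b) * Real.cot (π * k / b) := by
  have : NeZero b := ⟨hb.ne'⟩
  have hb' : (b : ℂ) ≠ 0 := by exact_mod_cast hb.ne'
  have h0 : ∑ k ∈ Finset.Icc 1 (b - 1), Real.cot (π * k * a / b) * Real.cot (π * k / b)
      = ∑ k ∈ Finset.range b, Real.cot (π * k * a / b) * Real.cot (π * k / b) := by
    refine Finset.sum_subset ?_ ?_
    · intro k hk
      simp only [Finset.mem_Icc, Finset.mem_range] at *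
      omega
    · intro k hk hk'
      simp only [Finset.mem_Icc, Finset.mem_range] at *
      have : k = 0 := by omega
      subst this
      simp [Real.cot_eq_cos_div_sin]
  rw [h0]
  have key := parseval_aux b (a : ZMod b) (fun x => (sawtooth ((x.val : ℝ) / b) : ℂ))
  simp only [saw_hat] at key
  rw [sum_zmod_range, sum_zmod_range] at key
  have hL : ((dedekindSum a b : ℝ) : ℂ) = ∑ j ∈ Finset.range b,
      (sawtooth ((((j : ZMod b) * (a : ZMod b)).val : ℝ) / b) : ℂ) *
      (sawtooth (((j : ZMod b).val : ℝ) / b) : ℂ) := by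
    unfold dedekindSum
    push_cast
    refine Finset.sum_congr rfl fun j hj => ?_
    rw [← Nat.cast_mul, ← Nat.cast_mul, ZMod.val_natCast, ZMod.val_natCast, ← sawtooth_mod b hb, ← sawtooth_mod b hb]
  have hR : ((∑ k ∈ Finset.range b, Real.cot (π * k * a / b) * Real.cot (π * k / b) : ℝ) : ℂ)
      = 4 * (b * ((dedekindSum a b : ℝ) : ℂ)) := by
    rw [hL, ← key, Finset.mul_sum, Complex.ofReal_sum]
    refine Finset.sum_congr rfl fun k _ => ?_
    have e : π * k * a / b = π * ((k * a : ℕ) : ℝ) / b := by push_cast; ring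
    rw [Complex.ofReal_mul, e, cot_char, cot_char, cot_mul, AddChar.map_neg_eq_inv, frac_neg]
    · push_cast; rfl
    · intro h
      have := AddChar.norm_apply (ZMod.stdAddChar (N := b)) (k : ZMod b)
      rw [h] at this
      simp at this
  have : ((dedekindSum a b : ℝ) : ℂ) = ((1 / (4 * b) * ∑ k ∈ Finset.range b, Real.cot (π * k * a / b) * Real.cot (π * k / b) : ℝ) : ℂ) := by
    rw [Complex.ofReal_mul, hR]
    push_cast
    field_simp
  exact_mod_cast this
end

section
/- (Dedekind reciprocity law) If a, b are relatively prime positive integers, then s(a,b) + s(b,a) = -1/4 + (1/12)(a/b + 1/(ab) + b/a). -/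
open Real Finset
open scoped Classical

lemma ded_perm (a b : ℕ) (hb : 0 < b) (hab : Nat.Coprime a b) (f : ℕ → ℝ) :
    ∑ k ∈ Finset.range b, f (k * a % b) = ∑ k ∈ Finset.range b, f k := by
  have hm : Set.MapsTo (fun k => k * a % b) (Finset.range b : Set ℕ) (Finset.range b : Set ℕ) := by
    intro k _
    simpa using Nat.mod_lt _ hb
  have hi : Set.InjOn (fun k => k * a % b) (Finset.range b : Set ℕ) := by
    intro x hx y hy hxy
    simp only [Finset.coe_range, Set.mem_Iio] at hx hy
    have h : x * a ≡ y * a [MOD b] := hxy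
    have h2 : x ≡ y [MOD b] := Nat.ModEq.cancel_right_of_coprime hab.symm h
    exact Nat.ModEq.eq_of_lt_of_lt h2 hx hy
  refine Finset.sum_nbij (fun k => k * a % b) (fun k hk => by simpa using hm (by simpa using hk)) hi
    (Finset.surjOn_of_injOn_of_card_le _ hm hi le_rfl) (fun _ _ => rfl)

lemma ded_saw (n b : ℕ) (hb : 0 < b) (h : ¬ b ∣ n) :
    sawtooth ((n : ℝ) / b) = (n : ℝ) / b - (n / b : ℕ) - 1 / 2 := by
  have hb' : (b : ℝ) ≠ 0 := by positivity
  unfold sawtooth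
  rw [if_neg, Int.fract, ← Nat.floor_div_eq_div (K := ℝ) n b, ← natCast_floor_eq_intCast_floor (by positivity)]
  rintro ⟨m, hm⟩
  apply h
  rw [div_eq_iff hb'] at hm
  have : (n : ℤ) = m * b := by exact_mod_cast hm
  exact Int.natCast_dvd_natCast.mp ⟨m, by rw [this]; ring⟩

lemma ded_formula (a b : ℕ) (hb : 0 < b) (hab : Nat.Coprime a b) :
    dedekindSum a b = ∑ k ∈ Finset.range b,
      (((k : ℝ) * a / b - (k * a / b : ℕ) - 1 / 2) * ((k : ℝ) / b - 1 / 2)) - 1 / 4 := by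
  unfold dedekindSum
  obtain ⟨c, rfl⟩ : ∃ c, b = c + 1 := ⟨b - 1, by omega⟩
  rw [Finset.sum_range_succ', Finset.sum_range_succ']
  have h0 : sawtooth 0 = 0 := by
    unfold sawtooth; rw [if_pos ⟨0, by simp⟩]
  have : ∀ k ∈ Finset.range c,
      sawtooth (((k + 1 : ℕ) : ℝ) * a / (c + 1 : ℕ)) * sawtooth (((k + 1 : ℕ) : ℝ) / (c + 1 : ℕ))
      = ((((k + 1 : ℕ) : ℝ) * a / (c + 1 : ℕ) - ((k + 1) * a / (c + 1) : ℕ) - 1 / 2) *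
        (((k + 1 : ℕ) : ℝ) / (c + 1 : ℕ) - 1 / 2)) := by
    intro k hk
    have hk := Finset.mem_range.mp hk
    have hd : ¬ (c + 1) ∣ (k + 1) := fun h => by
      have := Nat.le_of_dvd (by omega) h
      omega
    have h1 := ded_saw (k + 1) (c + 1) hb hd
    have h2 := ded_saw ((k + 1) * a) (c + 1) hb
      (fun h => hd (Nat.Coprime.dvd_of_dvd_mul_right hab.symm h))
    rw [Nat.div_eq_of_lt (by omega : k + 1 < c + 1)] at h1
    rw [Nat.cast_mul] at h2
    rw [h1, h2, Nat.cast_zero, sub_zero]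
  rw [Finset.sum_congr rfl this]
  simp [h0]
  ring

lemma ded_K1 (b : ℕ) : ∑ k ∈ Finset.range b, (k : ℝ) = b * (b - 1) / 2 := by
  induction b with
  | zero => simp
  | succ n ih => rw [Finset.sum_range_succ, ih]; push_cast; ring

lemma ded_K2 (b : ℕ) : ∑ k ∈ Finset.range b, (k : ℝ) ^ 2 = b * (b - 1) * (2 * b - 1) / 6 := by
  induction b with
  | zero => simp
  | succ n ih => rw [Finset.sum_range_succ, ih]; push_cast; ring

lemma ded_mod (n b : ℕ) : ((n % b : ℕ) : ℝ) = n - b * (n / b : ℕ) := by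
  have h : ((n % b + b * (n / b) : ℕ) : ℝ) = n := by rw [Nat.mod_add_div]
  push_cast at h
  linarith

lemma ded_R1 (a b : ℕ) (hb : 0 < b) (hab : Nat.Coprime a b) :
    a * (b * (b - 1) / 2 : ℝ) - b * ∑ k ∈ Finset.range b, ((k * a / b : ℕ) : ℝ)
      = b * (b - 1) / 2 := by
  have h := ded_perm a b hb hab (fun k => (k : ℝ))
  simp only [ded_mod] at h
  rw [ded_K1, Finset.sum_sub_distrib, ← Finset.mul_sum] at h
  simp only [Nat.cast_mul] at h
  rw [← Finset.sum_mul, ded_K1] at h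
  linarith

lemma ded_R2 (a b : ℕ) (hb : 0 < b) (hab : Nat.Coprime a b) :
    a ^ 2 * (b * (b - 1) * (2 * b - 1) / 6 : ℝ)
      - 2 * a * b * ∑ k ∈ Finset.range b, (k : ℝ) * ((k * a / b : ℕ) : ℝ)
      + b ^ 2 * ∑ k ∈ Finset.range b, ((k * a / b : ℕ) : ℝ) ^ 2
      = b * (b - 1) * (2 * b - 1) / 6 := by
  have h := ded_perm a b hb hab (fun k => (k : ℝ) ^ 2)
  simp only [ded_mod] at h
  rw [← ded_K2]
  refine Eq.trans ?_ h
  rw [Finset.mul_sum, Finset.mul_sum, Finset.mul_sum, ← Finset.sum_sub_distrib,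
    ← Finset.sum_add_distrib]
  refine Finset.sum_congr rfl fun k _ => ?_
  push_cast
  ring

lemma ded_odd (n : ℕ) : ∑ j ∈ Finset.range (n + 1), (2 * (j : ℝ) - 1) = (n : ℝ) ^ 2 - 1 := by
  induction n with
  | zero => simp
  | succ n ih => rw [Finset.sum_range_succ, ih]; push_cast; ring

lemma ded_lat (a b : ℕ) (ha : 0 < a) (hb : 0 < b) (hab : Nat.Coprime a b) :
    ∑ k ∈ Finset.range b, (((k * a / b : ℕ) : ℝ) ^ 2 - 1)
      = ∑ j ∈ Finset.range a, (2 * (j : ℝ) - 1) * (b - 1 - (j * b / a : ℕ)) - 1 := by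
  have h1 : ∀ k ∈ Finset.range b, (((k * a / b : ℕ) : ℝ) ^ 2 - 1)
      = ∑ j ∈ Finset.range a, if j * b ≤ k * a then (2 * (j : ℝ) - 1) else 0 := by
    intro k hk
    have hk := Finset.mem_range.mp hk
    rw [← ded_odd, ← Finset.sum_filter]
    congr 1
    ext j
    simp only [Finset.mem_range, Finset.mem_filter]
    rw [Nat.lt_succ_iff, Nat.le_div_iff_mul_le hb]
    constructor
    · intro h
      refine ⟨?_, h⟩
      by_contra hc
      push Not at hc
      nlinarith
    · exact fun h => h.2
  rw [Finset.sum_congr rfl h1, Finset.sum_comm]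
  have h2 : ∀ j ∈ Finset.range a,
      (∑ k ∈ Finset.range b, if j * b ≤ k * a then (2 * (j : ℝ) - 1) else 0)
      = (2 * (j : ℝ) - 1) * (b - 1 - (j * b / a : ℕ)) - (if j = 0 then 1 else 0) := by
    intro j hj
    have hj := Finset.mem_range.mp hj
    rw [← Finset.sum_filter, Finset.sum_const, nsmul_eq_mul]
    rcases Nat.eq_zero_or_pos j with rfl | hj0
    · simp
    rw [if_neg (by omega)]
    have hlt : j * b / a < b := by
      rw [Nat.div_lt_iff_lt_mul ha]; nlinarith
    have hf : (Finset.range b).filter (fun k => j * b ≤ k * a) = Finset.Ico (j * b / a + 1) b := by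
      ext k
      simp only [Finset.mem_range, Finset.mem_filter, Finset.mem_Ico]
      rw [Nat.succ_le_iff, Nat.div_lt_iff_lt_mul ha]
      constructor
      · rintro ⟨h, h'⟩
        refine ⟨lt_of_le_of_ne h' fun he => ?_, h⟩
        have : a ∣ j := Nat.Coprime.dvd_of_dvd_mul_right hab ⟨k, by rw [he]; ring⟩
        have := Nat.le_of_dvd hj0 this
        omega
      · exact fun h => ⟨h.2, h.1.le⟩
    rw [hf, Nat.card_Ico, Nat.cast_sub (by omega)]
    push_cast
    ring
  rw [Finset.sum_congr rfl h2, Finset.sum_sub_distrib]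
  congr 1
  simp [ha]

lemma ded_expand (a b : ℕ) (hb : 0 < b) (hab : Nat.Coprime a b) :
    dedekindSum a b = a / b ^ 2 * (b * (b - 1) * (2 * b - 1) / 6 : ℝ)
      - (a / (2 * b) + 1 / (2 * b)) * (b * (b - 1) / 2 : ℝ)
      - 1 / b * ∑ k ∈ Finset.range b, (k : ℝ) * ((k * a / b : ℕ) : ℝ)
      + 1 / 2 * ∑ k ∈ Finset.range b, ((k * a / b : ℕ) : ℝ) + b / 4 - 1 / 4 := by
  rw [ded_formula a b hb hab, ← ded_K1, ← ded_K2]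
  have h : (b : ℝ) / 4 = ∑ k ∈ Finset.range b, (1 / 4 : ℝ) := by simp; ring
  rw [h]
  simp only [Finset.mul_sum, ← Finset.sum_sub_distrib, ← Finset.sum_add_distrib]
  congr 1
  refine Finset.sum_congr rfl fun k _ => ?_
  have : (b : ℝ) ≠ 0 := by positivity
  field_simp
  ring

/-- Dedekind's reciprocity law:
`s(a,b) + s(b,a) = -1/4 + (1/12)(a/b + 1/(ab) + b/a)` for coprime positive `a, b`. -/
theorem dedekindSum_reciprocity (a b : ℕ) (ha : 0 < a) (hb : 0 < b) (hab : Nat.Coprime a b) :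
    dedekindSum a b + dedekindSum b a =
      -1/4 + 1/12 * ((a : ℝ) / b + 1 / (a * b) + (b : ℝ) / a) := by
  have e1 := ded_expand a b hb hab
  have e2 := ded_expand b a ha hab.symm
  have q1 := ded_R1 a b hb hab
  have p1 := ded_R1 b a ha hab.symm
  have q2 := ded_R2 a b hb hab
  have l := ded_lat a b ha hb hab
  have hl : ∑ j ∈ Finset.range a, (2 * (j : ℝ) - 1) * (b - 1 - (j * b / a : ℕ))
      = 2 * (b - 1) * (a * (a - 1) / 2 : ℝ) - a * (b - 1)
        - 2 * ∑ j ∈ Finset.range a, (j : ℝ) * ((j * b / a : ℕ) : ℝ)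
        + ∑ j ∈ Finset.range a, ((j * b / a : ℕ) : ℝ) := by
    have h : (a : ℝ) * (b - 1) = ∑ k ∈ Finset.range a, (b - 1 : ℝ) := by simp; ring
    rw [← ded_K1, h]
    simp only [Finset.mul_sum, ← Finset.sum_sub_distrib, ← Finset.sum_add_distrib]
    refine Finset.sum_congr rfl fun k _ => ?_
    ring
  rw [hl, Finset.sum_sub_distrib] at l
  simp only [Finset.sum_const, Finset.card_range, nsmul_eq_mul, mul_one] at l
  rw [e1, e2]
  generalize ∑ k ∈ Finset.range b, (k : ℝ) * ((k * a / b : ℕ) : ℝ) = Sq at *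
  generalize ∑ k ∈ Finset.range a, (k : ℝ) * ((k * b / a : ℕ) : ℝ) = Sp at *
  generalize ∑ k ∈ Finset.range b, ((k * a / b : ℕ) : ℝ) ^ 2 = Q2 at *
  generalize ∑ k ∈ Finset.range b, ((k * a / b : ℕ) : ℝ) = Q1 at *
  generalize ∑ k ∈ Finset.range a, ((k * b / a : ℕ) : ℝ) = P1 at *
  have ha' : (a : ℝ) ≠ 0 := by positivity
  have hb' : (b : ℝ) ≠ 0 := by positivity
  clear e1 e2 hl
  generalize (a : ℝ) = x at *
  generalize (b : ℝ) = y at *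
  have hQ1 : Q1 = (x - 1) * (y - 1) / 2 := by
    apply mul_left_cancel₀ hb'; linarith
  have hP1 : P1 = (x - 1) * (y - 1) / 2 := by
    apply mul_left_cancel₀ ha'; linarith
  have hQ2 : Q2 = 2 * (y - 1) * (x * (x - 1) / 2) - x * (y - 1) - 2 * Sp + P1 - 1 + y := by linarith
  have hSq : Sq = (x ^ 2 * (y * (y - 1) * (2 * y - 1) / 6) + y ^ 2 * Q2
      - y * (y - 1) * (2 * y - 1) / 6) / (2 * x * y) := by
    rw [eq_div_iff (by positivity)]; linarith
  rw [hSq, hQ2, hP1, hQ1]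
  field_simp
  ring
end

section
/- (Reciprocity law for Dedekind cotangent sums) Let a_0,...,a_d be positive integers, m_0,...,m_d nonnegative integers, and z_0,...,z_d complex numbers. Assume that for all distinct i, j in {0,...,d} and all integers m, n, the number (m+z_i)/a_i − (n+z_j)/a_j is not an integer. Then Σ_{n=0}^{d} (−1)^{m_n} m_n! Σ_{l_0,...,l_d ≥ 0 (omitting l_n), l_0+···+l_d (omitting l_n) = m_n} (Π_{j≠n} a_j^{l_j}/l_j!) · c(a_n | a_0,...,a_d omitting a_n ; m_n | m_0+l_0,...,m_d+l_d omitting index n ; z_n | z_0,...,z_d omitting z_n) equals (−1)^{d/2} if all m_k are zero and d is even, and equals 0 otherwise. -/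
open Real Finset
open scoped Classical

/-- The Dedekind cotangent sum
`c(a₀ | a ; m₀ | m ; z₀ | z) = (1/a₀^(m₀+1)) Σ_{k mod a₀} Π_j cot^{(m_j)}(π(a_j(k+z₀)/a₀ − z_j))`,
where the sum is over the residues `k mod a₀` for which the summand is nonsingular
(i.e. no argument of a cotangent derivative is an integer multiple of π). -/
noncomputable def dedekindCotangentSum (a₀ : ℕ) (m₀ : ℕ) (z₀ : ℂ) {ι : Type*} [Fintype ι]
    (a : ι → ℕ) (m : ι → ℕ) (z : ι → ℂ) : ℂ :=
  (1 / (a₀ : ℂ) ^ (m₀ + 1)) *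
    ∑ k ∈ (Finset.range a₀).filter
        (fun k => ∀ j, ¬∃ n : ℤ, (a j : ℂ) * (((k : ℂ) + z₀) / a₀) - z j = n),
      ∏ j, iteratedDeriv (m j) Complex.cot
        ((Real.pi : ℂ) * ((a j : ℂ) * (((k : ℂ) + z₀) / a₀) - z j))


lemma prod_split {d : ℕ} {M : Type*} [CommMonoid M] (n : Fin (d+1)) (f : Fin (d+1) → M) :
    ∏ j, f j = f n * ∏ j : {j : Fin (d+1) // j ≠ n}, f j.1 := by
  rw [← Finset.mul_prod_erase univ f (Finset.mem_univ n)]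
  congr 1
  exact Finset.prod_subtype _ (by simp) f

lemma cot_ratio (w s z : ℂ) (hs : s ≠ 0) (h : Complex.exp (2 * Complex.I * z) = w / s) :
    Complex.cot z = Complex.I * ((w + s) / (w - s)) := by
  rw [Complex.cot_eq_exp_ratio, h]
  have hI := Complex.I_ne_zero
  by_cases hw : w = s
  · subst hw; simp [hs]
  · have h1 : w - s ≠ 0 := sub_ne_zero.2 hw
    have h2 : s - w ≠ 0 := sub_ne_zero.2 (Ne.symm hw)
    have : Complex.I * (1 - w / s) = (w - s) * (-Complex.I / s) := by field_simp; ring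
    rw [this]
    field_simp
    rw [Complex.I_sq]; ring

/-- nonsingular configurations -/
def GoodZ {d : ℕ} (a : Fin (d+1) → ℕ) (z : Fin (d+1) → ℂ) : Prop :=
  ∀ n j : Fin (d+1), j ≠ n → ∀ k ∈ Finset.range (a n),
    Complex.sin ((Real.pi : ℂ) * ((a j : ℂ) * (((k : ℂ) + z n) / a n) - z j)) ≠ 0

open Polynomial in
lemma base_case (d : ℕ) (a : Fin (d + 1) → ℕ) (ha : ∀ i, 0 < a i)
    (z : Fin (d + 1) → ℂ) (hz : GoodZ a z) :
    ∑ n : Fin (d+1), (1 / (a n : ℂ)) * ∑ k ∈ Finset.range (a n),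
      ∏ j : {j : Fin (d+1) // j ≠ n},
        Complex.cot ((Real.pi : ℂ) * ((a j.1 : ℂ) * (((k : ℂ) + z n) / a n) - z j.1))
      = Complex.I ^ d * (1 + (-1) ^ d) / 2 := by
  have ha' : ∀ i, (a i : ℂ) ≠ 0 := fun i => by exact_mod_cast (ha i).ne'
  set s : Fin (d+1) → ℂ := fun j => Complex.exp (2 * Real.pi * Complex.I * z j) with hs
  have hs0 : ∀ j, s j ≠ 0 := fun j => Complex.exp_ne_zero _
  set v : (Σ _ : Fin (d+1), ℕ) → ℂ :=
    fun p => Complex.exp (2 * Real.pi * Complex.I * (((p.2 : ℂ) + z p.1) / a p.1)) with hv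
  have hv0 : ∀ p, v p ≠ 0 := fun j => Complex.exp_ne_zero _
  set S : Finset (Σ _ : Fin (d+1), ℕ) := Finset.univ.sigma (fun n => Finset.range (a n)) with hS
  have hvpow : ∀ p, v p ^ a p.1 = s p.1 := by
    intro p
    simp only [hv, hs]
    rw [← Complex.exp_nat_mul, Complex.exp_eq_exp_iff_exists_int]
    refine ⟨p.2, ?_⟩
    have := ha' p.1
    push_cast
    field_simp
    ring
  have hexp : ∀ p j, Complex.exp (2 * Complex.I * ((Real.pi : ℂ) * ((a j : ℂ) * (((p.2 : ℂ) + z p.1) / a p.1) - z j))) = v p ^ a j / s j := by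
    intro p j
    simp only [hv, hs]
    rw [← Complex.exp_nat_mul, ← Complex.exp_sub]
    congr 1; ring
  have hne : ∀ p ∈ S, ∀ j, j ≠ p.1 → v p ^ a j - s j ≠ 0 := by
    intro p hp j hj h0
    have hk : p.2 ∈ Finset.range (a p.1) := by simpa [hS] using hp
    apply hz p.1 j hj p.2 hk
    have h1 := hexp p j
    rw [sub_eq_zero.1 h0, div_self (hs0 j), Complex.exp_eq_one_iff] at h1
    obtain ⟨N, hN⟩ := h1
    rw [Complex.sin_eq_zero_iff]
    refine ⟨N, ?_⟩
    have : (2 * Complex.I) ≠ 0 := by simp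
    apply mul_left_cancel₀ this
    rw [hN]; ring
  have hinj : Set.InjOn v S := by
    intro p hp q hq hpq
    have hk : p.2 < (a p.1) := by simpa [hS] using hp
    have hk' : q.2 < (a q.1) := by simpa [hS] using hq
    obtain ⟨n, k⟩ := p
    obtain ⟨n', k'⟩ := q
    have hn : n' = n := by
      by_contra hcon
      apply hne ⟨n, k⟩ hp n' hcon
      rw [hpq, sub_eq_zero]
      exact hvpow ⟨n', k'⟩
    subst hn
    congr 1
    simp only [hv] at hpq
    rw [Complex.exp_eq_exp_iff_exists_int] at hpq
    obtain ⟨N, hN⟩ := hpq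
    have h2 : (2 * Real.pi * Complex.I : ℂ) ≠ 0 := Complex.two_pi_I_ne_zero
    have h3 : ((k : ℂ) + z n') / a n' = ((k' : ℂ) + z n') / a n' + N := by
      apply mul_left_cancel₀ h2; rw [hN]; ring
    have h4 : (k : ℂ) = k' + N * a n' := by
      have := ha' n'
      field_simp at h3
      linear_combination h3
    have h5 : (k : ℤ) = k' + N * a n' := by exact_mod_cast h4
    have h6 : (k : ℤ) % a n' = k' % a n' := by rw [h5]; simp
    have : k % a n' = k' % a n' := by exact_mod_cast h6
    rwa [Nat.mod_eq_of_lt hk, Nat.mod_eq_of_lt hk'] at this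
  set P : ℂ[X] := ∏ j, (X ^ a j - C (s j)) with hP
  set Q : ℂ[X] := ∏ j, (X ^ a j + C (s j)) with hQ
  have hnodal : Lagrange.nodal S v = P := by
    rw [Lagrange.nodal_eq, hS, Finset.prod_sigma]
    refine Finset.prod_congr rfl fun n _ => ?_
    rw [X_pow_sub_C_eq_prod (Complex.isPrimitiveRoot_exp (a n) (ha n).ne') (α := v ⟨n, 0⟩) (ha n) (hvpow ⟨n, 0⟩)]
    refine Finset.prod_congr rfl fun k _ => ?_
    congr 2
    simp only [hv]
    rw [← Complex.exp_nat_mul, ← Complex.exp_add]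
    congr 1; push_cast; ring
  have hPm : P.Monic := monic_prod_of_monic _ _ fun j _ => monic_X_pow_sub_C _ (ha j).ne'
  have hQm : Q.Monic := monic_prod_of_monic _ _ fun j _ => monic_X_pow_add_C _ (ha j).ne'
  have hdeg : Q.degree = P.degree := by
    rw [hP, hQ, degree_prod, degree_prod]
    refine Finset.sum_congr rfl fun j _ => ?_
    rw [degree_X_pow_add_C (ha j), degree_X_pow_sub_C (ha j)]
  have hR : (Q - P).degree < S.card := by
    rw [← Lagrange.degree_nodal (s := S) (v := v), hnodal, ← hdeg]
    exact degree_sub_lt_left hdeg hQm.ne_zero (by rw [hPm.leadingCoeff, hQm.leadingCoeff])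
  have key := Lagrange.eval_interpolate_not_at_node (s := S) (v := v) (fun i => eval (v i) (Q - P)) (x := 0)
    (fun i _ => (hv0 i).symm)
  rw [← Lagrange.eq_interpolate hinj hR, hnodal] at key
  have hP0 : eval 0 P = (-1) ^ (d+1) * ∏ j, s j := by
    rw [hP, eval_prod]
    simp only [eval_sub, eval_pow, eval_X, eval_C, zero_pow (ha _).ne', zero_sub]
    rw [Finset.prod_neg]; simp
  have hQ0 : eval 0 Q = ∏ j, s j := by
    rw [hQ, eval_prod]
    simp only [eval_add, eval_pow, eval_X, eval_C, zero_pow (ha _).ne', zero_add]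
  have hsp : ∏ j, s j ≠ 0 := Finset.prod_ne_zero_iff.2 fun j _ => hs0 j
  have hterm : ∀ p ∈ S, Lagrange.nodalWeight S v p * (0 - v p)⁻¹ * eval (v p) (Q - P)
      = -2 * (-Complex.I) ^ d * ((1 / (a p.1 : ℂ)) * ∏ j : {j : Fin (d+1) // j ≠ p.1},
        Complex.cot ((Real.pi : ℂ) * ((a j.1 : ℂ) * (((p.2 : ℂ) + z p.1) / a p.1) - z j.1))) := by
    intro p hp
    rw [Lagrange.nodalWeight_eq_eval_derivative_nodal hp, hnodal]
    have e1 : eval (v p) P = 0 := by rw [← hnodal]; exact Lagrange.eval_nodal_at_node hp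
    have e2 : eval (v p) Q = 2 * s p.1 * ∏ j : {j : Fin (d+1) // j ≠ p.1}, (v p ^ a j.1 + s j.1) := by
      rw [hQ, eval_prod, prod_split p.1]
      simp only [eval_add, eval_pow, eval_X, eval_C, hvpow]
      ring
    have e3 : eval (v p) (derivative P) = a p.1 * v p ^ (a p.1 - 1) *
        ∏ j : {j : Fin (d+1) // j ≠ p.1}, (v p ^ a j.1 - s j.1) := by
      rw [hP, prod_split p.1, derivative_mul, eval_add, eval_mul, eval_mul, eval_prod]
      simp [hvpow, derivative_X_pow]
    have e4 : v p ^ (a p.1 - 1) * v p = s p.1 := by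
      rw [← pow_succ, Nat.sub_add_cancel (ha _), hvpow]
    have e5 : ∏ j : {j : Fin (d+1) // j ≠ p.1},
        Complex.cot ((Real.pi : ℂ) * ((a j.1 : ℂ) * (((p.2 : ℂ) + z p.1) / a p.1) - z j.1))
        = Complex.I ^ d * ((∏ j : {j : Fin (d+1) // j ≠ p.1}, (v p ^ a j.1 + s j.1)) /
          ∏ j : {j : Fin (d+1) // j ≠ p.1}, (v p ^ a j.1 - s j.1)) := by
      rw [Finset.prod_congr rfl fun j _ => cot_ratio _ _ _ (hs0 j.1) (hexp p j.1)]
      rw [Finset.prod_mul_distrib, Finset.prod_div_distrib]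
      simp [Fintype.card_subtype_compl]
    have e6 : (∏ j : {j : Fin (d+1) // j ≠ p.1}, (v p ^ a j.1 - s j.1)) ≠ 0 :=
      Finset.prod_ne_zero_iff.2 fun j _ => hne p hp j.1 j.2
    rw [eval_sub, e1, e2, e3, e5, sub_zero, zero_sub]
    have e7 : (-Complex.I) ^ d * Complex.I ^ d = 1 := by
      rw [← mul_pow]; simp
    have h1 := hv0 p
    have h2 := ha' p.1
    rw [← e4]
    generalize (∏ j : {j : Fin (d+1) // j ≠ p.1}, (v p ^ a j.1 - s j.1)) = E at *
    generalize (∏ j : {j : Fin (d+1) // j ≠ p.1}, (v p ^ a j.1 + s j.1)) = F at *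
    have h3 : v p ^ (a p.1 - 1) ≠ 0 := pow_ne_zero _ h1
    generalize v p ^ (a p.1 - 1) = W at *
    field_simp
    linear_combination F * e7
  rw [Finset.sum_congr rfl hterm, ← Finset.mul_sum, hS, Finset.sum_sigma, eval_sub, hP0, hQ0] at key
  simp only [← Finset.mul_sum] at key
  generalize (∑ n : Fin (d+1), (1 / (a n : ℂ)) * ∑ k ∈ Finset.range (a n),
      ∏ j : {j : Fin (d+1) // j ≠ n},
        Complex.cot ((Real.pi : ℂ) * ((a j.1 : ℂ) * (((k : ℂ) + z n) / a n) - z j.1))) = T at *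
  have e7 : Complex.I ^ d * (-Complex.I) ^ d = 1 := by
    rw [← mul_pow]; simp
  have e8 : ((-1 : ℂ) ^ d) * (-1) ^ d = 1 := by rw [← mul_pow]; simp
  have k2 : 1 - (-1) ^ (d+1) = (-1) ^ (d+1) * (-2 * (-Complex.I) ^ d * T) := by
    apply mul_right_cancel₀ hsp
    linear_combination key
  rw [pow_succ] at k2
  linear_combination (-T) * e7 - Complex.I ^ d * (-1)^d / 2 * k2
    + (Complex.I ^ d / 2 - (Complex.I ^ d) * (-Complex.I) ^ d * T) * e8

lemma cot_hasDerivAt (l : ℕ) (w : ℂ) (hw : Complex.sin w ≠ 0) :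
    HasDerivAt (iteratedDeriv l Complex.cot) (iteratedDeriv (l+1) Complex.cot w) w := by
  have h1 : AnalyticAt ℂ Complex.cot w := by
    have e : Complex.cot = fun z => Complex.cos z / Complex.sin z := by
      funext z; rfl
    rw [e]
    exact (Complex.analyticAt_cos).div (Complex.analyticAt_sin) hw
  have h2 : AnalyticAt ℂ (iteratedDeriv l Complex.cot) w := by
    rw [iteratedDeriv_eq_iterate]
    exact h1.iterated_deriv l
  rw [iteratedDeriv_succ]
  exact h2.differentiableAt.hasDerivAt

/-- coefficientwise derivative of a family of power series -/
def CD (P : ℂ → PowerSeries ℂ) (P' : PowerSeries ℂ) (t : ℂ) : Prop :=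
  ∀ l, HasDerivAt (fun s => PowerSeries.coeff l (P s)) (PowerSeries.coeff l P') t

lemma CD.mul {P Q : ℂ → PowerSeries ℂ} {P' Q' : PowerSeries ℂ} {t : ℂ}
    (hP : CD P P' t) (hQ : CD Q Q' t) :
    CD (fun s => P s * Q s) (P' * Q t + P t * Q') t := by
  intro l
  simp only [map_add, PowerSeries.coeff_mul, ← Finset.sum_add_distrib]
  exact HasDerivAt.fun_sum fun x _ => (hP x.1).mul (hQ x.2)

lemma CD.prod {ι : Type*} (S : Finset ι) (c : ℂ) {P : ι → ℂ → PowerSeries ℂ} {t : ℂ}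
    (hP : ∀ j ∈ S, CD (P j) (c • PowerSeries.derivative ℂ (P j t)) t) :
    CD (fun s => ∏ j ∈ S, P j s) (c • PowerSeries.derivative ℂ (∏ j ∈ S, P j t)) t := by
  classical
  induction S using Finset.induction_on with
  | empty =>
    intro l
    simpa using hasDerivAt_const t _
  | insert i S hi ih =>
    have h1 := (hP i (Finset.mem_insert_self _ _)).mul
      (ih fun j hj => hP j (Finset.mem_insert_of_mem hj))
    simp only [Finset.prod_insert hi]
    convert h1 using 1
    rw [Derivation.leibniz]
    simp only [smul_eq_mul, smul_add, smul_mul_assoc, mul_smul_comm]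
    rw [add_comm, mul_comm (PowerSeries.derivative ℂ (P i t))]

/-- the factor series -/
noncomputable def PS {d : ℕ} (a m : Fin (d+1) → ℕ) (z : Fin (d+1) → ℂ) (n : Fin (d+1)) (k : ℕ)
    (j : Fin (d+1)) : PowerSeries ℂ :=
  PowerSeries.mk fun l => ((a j : ℂ) / a n) ^ l / (Nat.factorial l : ℂ) *
    iteratedDeriv (m j + l) Complex.cot
      ((Real.pi : ℂ) * ((a j : ℂ) * (((k : ℂ) + z n) / a n) - z j))

/-- the n-th term -/
noncomputable def TT {d : ℕ} (a m : Fin (d+1) → ℕ) (z : Fin (d+1) → ℂ) (n : Fin (d+1)) : ℂ :=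
  (-1 : ℂ) ^ (m n) * (Nat.factorial (m n) : ℂ) * ((1 / (a n : ℂ)) * ∑ k ∈ Finset.range (a n),
    PowerSeries.coeff (m n) (∏ j : {j : Fin (d+1) // j ≠ n}, PS a m z n k j.1))

lemma PS_deriv_self {d : ℕ} (a m : Fin (d+1) → ℕ)
    (z : Fin (d+1) → ℂ) (hz : GoodZ a z) (n j : Fin (d+1)) (hj : j ≠ n) (k : ℕ)
    (hk : k ∈ Finset.range (a n)) :
    CD (fun t => PS a m (Function.update z n t) n k j)
      ((Real.pi : ℂ) • PowerSeries.derivative ℂ (PS a m (Function.update z n (z n)) n k j)) (z n) := by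
  intro l
  simp only [Function.update_eq_self, PowerSeries.coeff_smul, PowerSeries.coeff_derivative]
  simp only [PS, PowerSeries.coeff_mk, Function.update_self, Function.update_of_ne hj]
  have h1 : HasDerivAt (fun t : ℂ => (Real.pi : ℂ) * ((a j : ℂ) * (((k : ℂ) + t) / a n) - z j))
      (Real.pi * (a j * (1 / a n))) (z n) :=
    (((((hasDerivAt_id (z n)).const_add (k : ℂ)).div_const _).const_mul _).sub_const _).const_mul _
  have h2 := ((cot_hasDerivAt (m j + l) _ (hz n j hj k hk)).comp (z n) h1).const_mul
    (((a j : ℂ) / a n) ^ l / (Nat.factorial l : ℂ))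
  refine h2.congr_deriv ?_
  have hf : (Nat.factorial l : ℂ) ≠ 0 := by exact_mod_cast (Nat.factorial_pos l).ne'
  have hl : (l + 1 : ℂ) ≠ 0 := by exact_mod_cast (Nat.succ_ne_zero l)
  rw [Nat.factorial_succ, ← add_assoc, smul_eq_mul]
  push_cast
  rw [pow_succ]
  field_simp

lemma PS_deriv_other {d : ℕ} (a m : Fin (d+1) → ℕ)
    (z : Fin (d+1) → ℂ) (hz : GoodZ a z) (n i : Fin (d+1)) (hi : i ≠ n) (k : ℕ)
    (hk : k ∈ Finset.range (a n)) :
    CD (fun t => PS a m (Function.update z i t) n k i)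
      ((-Real.pi : ℂ) • PS a (m + Pi.single i 1) z n k i) (z i) := by
  intro l
  simp only [PowerSeries.coeff_smul]
  simp only [PS, PowerSeries.coeff_mk, Function.update_self, Function.update_of_ne hi.symm]
  have h1 : HasDerivAt (fun t : ℂ => (Real.pi : ℂ) * ((a i : ℂ) * (((k : ℂ) + z n) / a n) - t))
      (Real.pi * (-1)) (z i) :=
    ((hasDerivAt_id (z i)).const_sub _).const_mul _
  have h2 := ((cot_hasDerivAt (m i + l) _ (hz n i hi k hk)).comp (z i) h1).const_mul
    (((a i : ℂ) / a n) ^ l / (Nat.factorial l : ℂ))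
  refine h2.congr_deriv ?_
  have : (m + Pi.single i 1 : Fin (d+1) → ℕ) i + l = m i + l + 1 := by simp; ring
  rw [this, smul_eq_mul]
  ring

lemma prod_erase_univ {ι M : Type*} [Fintype ι] [DecidableEq ι] [CommMonoid M] (f : ι → M) (i : ι) :
    ∏ j, f j = f i * ∏ j ∈ Finset.univ.erase i, f j :=
  (Finset.mul_prod_erase Finset.univ f (Finset.mem_univ i)).symm

lemma TT_deriv {d : ℕ} (a m : Fin (d+1) → ℕ)
    (z : Fin (d+1) → ℂ) (hz : GoodZ a z) (n i : Fin (d+1)) :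
    HasDerivAt (fun t => TT a m (Function.update z i t) n)
      ((-Real.pi : ℂ) * TT a (m + Pi.single i 1) z n) (z i) := by
  by_cases hi : i = n
  · subst hi
    have h1 : ∀ k ∈ Finset.range (a i), HasDerivAt (fun t => PowerSeries.coeff (m i)
        (∏ j : {j : Fin (d+1) // j ≠ i}, PS a m (Function.update z i t) i k j.1))
        (Real.pi * (PowerSeries.coeff (m i + 1)
          (∏ j : {j : Fin (d+1) // j ≠ i}, PS a (m + Pi.single i 1) z i k j.1) * (m i + 1))) (z i) := by
      intro k hk
      have := CD.prod (Finset.univ : Finset {j : Fin (d+1) // j ≠ i}) (Real.pi : ℂ) (t := z i)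
        (P := fun j t => PS a m (Function.update z i t) i k j.1)
        (fun j _ => PS_deriv_self a m z hz i j.1 j.2 k hk) (m i)
      refine this.congr_deriv ?_
      simp only [PowerSeries.coeff_smul, PowerSeries.coeff_derivative, smul_eq_mul,
        Function.update_eq_self]
      have e : ∏ j : {j : Fin (d+1) // j ≠ i}, PS a m z i k j.1 =
          ∏ j : {j : Fin (d+1) // j ≠ i}, PS a (m + Pi.single i 1) z i k j.1 := by
        refine Finset.prod_congr rfl fun j _ => ?_
        simp [PS, Pi.single_eq_of_ne j.2]
      rw [e]
    have h2 := ((HasDerivAt.fun_sum h1).const_mul (1 / (a i : ℂ))).const_mul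
      ((-1 : ℂ) ^ (m i) * (Nat.factorial (m i) : ℂ))
    refine h2.congr_deriv ?_
    have e : (m + Pi.single i 1 : Fin (d+1) → ℕ) i = m i + 1 := by simp
    rw [TT, e, Nat.factorial_succ, ← Finset.mul_sum, ← Finset.sum_mul]
    push_cast
    ring
  · have h1 : ∀ k ∈ Finset.range (a n), HasDerivAt (fun t => PowerSeries.coeff (m n)
        (∏ j : {j : Fin (d+1) // j ≠ n}, PS a m (Function.update z i t) n k j.1))
        ((-Real.pi) * (PowerSeries.coeff (m n)
          (∏ j : {j : Fin (d+1) // j ≠ n}, PS a (m + Pi.single i 1) z n k j.1))) (z i) := by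
      intro k hk
      have hc : CD (fun t => ∏ j ∈ (Finset.univ : Finset {j : Fin (d+1) // j ≠ n}).erase ⟨i, hi⟩,
          PS a m (Function.update z i t) n k j.1) ((0 : ℂ) • PowerSeries.derivative ℂ
          (∏ j ∈ (Finset.univ : Finset {j : Fin (d+1) // j ≠ n}).erase ⟨i, hi⟩,
          PS a m (Function.update z i (z i)) n k j.1)) (z i) := by
        refine CD.prod _ (0 : ℂ) (P := fun (j : {j : Fin (d+1) // j ≠ n}) t => PS a m (Function.update z i t) n k j.1) ?_
        intro j hj l
        have hji : j.1 ≠ i := fun h => (Finset.mem_erase.1 hj).1 (Subtype.ext h)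
        simp only [PS, Function.update_of_ne hji, Function.update_of_ne (Ne.symm hi)]
        simpa using hasDerivAt_const (z i) _
      have := ((PS_deriv_other a m z hz n i hi k hk).mul hc) (m n)
      rw [zero_smul, mul_zero, add_zero, smul_mul_assoc, PowerSeries.coeff_smul, smul_eq_mul] at this
      have e : ∀ t, ∏ j : {j : Fin (d+1) // j ≠ n}, PS a m (Function.update z i t) n k j.1
          = PS a m (Function.update z i t) n k i * ∏ j ∈ (Finset.univ : Finset {j : Fin (d+1) // j ≠ n}).erase ⟨i, hi⟩,
          PS a m (Function.update z i t) n k j.1 := fun t =>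
        prod_erase_univ (fun j : {j : Fin (d+1) // j ≠ n} => PS a m (Function.update z i t) n k j.1) ⟨i, hi⟩
      simp only [e]
      refine this.congr_deriv ?_
      have e' := prod_erase_univ (fun j : {j : Fin (d+1) // j ≠ n} => PS a (m + Pi.single i 1) z n k j.1) ⟨i, hi⟩
      simp only [] at e'
      rw [e', Function.update_eq_self]
      congr 3
      refine Finset.prod_congr rfl fun j hj => ?_
      have hji : j.1 ≠ i := fun h => (Finset.mem_erase.1 hj).1 (Subtype.ext h)
      simp [PS, Pi.single_eq_of_ne hji]
    have h2 := ((HasDerivAt.fun_sum h1).const_mul (1 / (a n : ℂ))).const_mul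
      ((-1 : ℂ) ^ (m n) * (Nat.factorial (m n) : ℂ))
    refine h2.congr_deriv ?_
    have e : (m + Pi.single i 1 : Fin (d+1) → ℕ) n = m n := by simp [Pi.single_eq_of_ne (Ne.symm hi)]
    rw [TT, e, ← Finset.mul_sum]
    ring

lemma GoodZ_eventually {d : ℕ} (a : Fin (d+1) → ℕ)
    (z : Fin (d+1) → ℂ) (hz : GoodZ a z) (i : Fin (d+1)) :
    ∀ᶠ t in nhds (z i), GoodZ a (Function.update z i t) := by
  unfold GoodZ
  rw [Filter.eventually_all]; intro n
  rw [Filter.eventually_all]; intro j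
  rw [Filter.eventually_imp_distrib_left]; intro hj
  rw [Filter.eventually_all_finset]; intro k hk
  have hc : Continuous fun t => Complex.sin ((Real.pi : ℂ) * ((a j : ℂ) *
      (((k : ℂ) + Function.update z i t n) / a n) - Function.update z i t j)) := by
    have h1 : Continuous fun t => Function.update z i t := continuous_const.update i continuous_id
    have h2 : ∀ q, Continuous fun t => Function.update z i t q := fun q => (continuous_apply q).comp h1
    have := h2 n
    have := h2 j
    fun_prop
  refine hc.continuousAt.eventually_ne ?_
  simpa using hz n j hj k hk

lemma TT_sum {d : ℕ} (a : Fin (d+1) → ℕ) (ha : ∀ i, 0 < a i) (N : ℕ) :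
    ∀ m : Fin (d+1) → ℕ, ∑ i, m i = N → ∀ z, GoodZ a z →
      ∑ n, TT a m z n = if ∀ k, m k = 0 then Complex.I ^ d * (1 + (-1) ^ d) / 2 else 0 := by
  induction N with
  | zero =>
    intro m hm z hz
    have hm0 : ∀ k, m k = 0 := by simpa using hm
    obtain rfl : m = 0 := funext hm0
    rw [if_pos hm0, ← base_case d a ha z hz]
    refine Finset.sum_congr rfl fun n _ => ?_
    simp [TT, PS, map_prod]
  | succ N ih =>
    intro m hm z hz
    obtain ⟨i, hi⟩ : ∃ i, m i ≠ 0 := by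
      by_contra hcon
      push Not at hcon
      simp [hcon] at hm
    rw [if_neg (fun h => hi (h i))]
    set m' : Fin (d+1) → ℕ := m - Pi.single i 1 with hm'
    have hmm : m = m' + Pi.single i 1 := by
      funext j
      by_cases hj : j = i
      · subst hj; simp [hm']; omega
      · simp [hm', Pi.single_eq_of_ne hj]
    have hs : ∑ i, m' i = N := by
      rw [hmm] at hm
      simp [Finset.sum_add_distrib] at hm
      exact hm
    have h1 := HasDerivAt.fun_sum (u := Finset.univ) fun n _ => TT_deriv a m' z hz n i
    have h2 : HasDerivAt (fun t => ∑ n, TT a m' (Function.update z i t) n) 0 (z i) := by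
      refine (hasDerivAt_const (z i) (if ∀ k, m' k = 0 then Complex.I ^ d * (1 + (-1) ^ d) / 2 else 0)).congr_of_eventuallyEq ?_
      filter_upwards [GoodZ_eventually a z hz i] with t ht
      exact ih m' hs _ ht
    have h3 := h1.unique h2
    rw [← Finset.mul_sum, ← hmm] at h3
    have : (-Real.pi : ℂ) ≠ 0 := by simp [Real.pi_ne_zero]
    exact (mul_eq_zero.1 h3).resolve_left this

lemma coeff_prod_pi {ι : Type*} [Fintype ι] [DecidableEq ι] (f : ι → PowerSeries ℂ) (M : ℕ) :
    PowerSeries.coeff M (∏ j, f j) =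
      ∑ l ∈ (Fintype.piFinset fun _ : ι => Finset.range (M + 1)).filter (fun l => ∑ j, l j = M),
        ∏ j, PowerSeries.coeff (l j) (f j) := by
  rw [PowerSeries.coeff_prod]
  refine Finset.sum_bij' (fun l _ => (l : ι → ℕ)) (fun l _ => Finsupp.equivFunOnFinite.symm l)
    ?_ ?_ ?_ ?_ ?_
  · intro l hl
    have h := (Finset.mem_finsuppAntidiag.1 hl).1
    simp only [Finset.mem_filter, Fintype.mem_piFinset, Finset.mem_range]
    refine ⟨fun j => ?_, h⟩
    have : l j ≤ ∑ j, l j := Finset.single_le_sum (f := l) (fun _ _ => Nat.zero_le _) (Finset.mem_univ j)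
    rw [h] at this
    omega
  · intro l hl
    have h := (Finset.mem_filter.1 hl).2
    simp [Finset.mem_finsuppAntidiag, h]
  · intro l _; ext; simp
  · intro l _; ext; simp
  · intro l _; rfl

lemma range_lift (N : ℕ) : (do let k ← Finset.range N; pure (k : ℂ)) =
    (Finset.range N).image (fun k : ℕ => (k : ℂ)) := by
  ext x
  simp [Finset.bind_def, Finset.pure_def, eq_comm]

/-- Reciprocity law for Dedekind cotangent sums. -/
theorem dedekindCotangentSum_reciprocity (d : ℕ) (a : Fin (d + 1) → ℕ) (ha : ∀ i, 0 < a i)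
    (m : Fin (d + 1) → ℕ) (z : Fin (d + 1) → ℂ)
    (h : ∀ i j : Fin (d + 1), i ≠ j → ∀ p q : ℤ, ∀ r : ℤ,
      ((p : ℂ) + z i) / (a i) - ((q : ℂ) + z j) / (a j) ≠ (r : ℂ)) :
    (∑ n : Fin (d + 1), (-1 : ℂ) ^ (m n) * (Nat.factorial (m n) : ℂ) *
      ∑ l ∈ (Fintype.piFinset fun _ : {j : Fin (d + 1) // j ≠ n} =>
              Finset.range (m n + 1)).filter (fun l => ∑ j, l j = m n),
        (∏ j : {j : Fin (d + 1) // j ≠ n}, (a j.1 : ℂ) ^ (l j) / (Nat.factorial (l j) : ℂ)) *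
          dedekindCotangentSum (a n) (m n) (z n)
            (fun j : {j : Fin (d + 1) // j ≠ n} => a j.1)
            (fun j : {j : Fin (d + 1) // j ≠ n} => m j.1 + l j)
            (fun j : {j : Fin (d + 1) // j ≠ n} => z j.1)) =
      if (∀ k, m k = 0) ∧ Even d then (-1 : ℂ) ^ (d / 2) else 0 := by
  have hz : GoodZ a z := by
    intro n j hj k _ h0
    rw [Complex.sin_eq_zero_iff] at h0
    obtain ⟨N, hN⟩ := h0
    have h1 : (a j : ℂ) * (((k : ℂ) + z n) / a n) - z j = N := by
      have : (Real.pi : ℂ) ≠ 0 := by simp [Real.pi_ne_zero]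
      apply mul_left_cancel₀ this
      rw [hN]; ring
    apply h n j hj.symm k N 0
    have h2 : (a j : ℂ) ≠ 0 := by exact_mod_cast (ha j).ne'
    rw [← h1]
    push_cast
    field_simp
    ring
  have key := TT_sum a ha _ m rfl z hz
  have hrhs : (if (∀ k, m k = 0) ∧ Even d then (-1 : ℂ) ^ (d / 2) else 0) =
      if ∀ k, m k = 0 then Complex.I ^ d * (1 + (-1) ^ d) / 2 else 0 := by
    by_cases hm : ∀ k, m k = 0
    · simp only [hm, implies_true, true_and, if_true]
      rcases Nat.even_or_odd d with hd | hd
      · rw [if_pos hd, hd.neg_one_pow]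
        obtain ⟨r, rfl⟩ := hd
        rw [← two_mul, pow_mul, Complex.I_sq]
        simp
        norm_num
      · rw [if_neg (by simpa using hd), hd.neg_one_pow]
        simp
    · simp only [hm, false_and, if_false]
  rw [hrhs, ← key]
  refine Finset.sum_congr rfl fun n _ => ?_
  rw [TT]
  congr 1
  simp only [coeff_prod_pi]
  rw [Finset.sum_comm, Finset.mul_sum]
  refine Finset.sum_congr rfl fun l hl => ?_
  have hl' := (Finset.mem_filter.1 hl).2
  rw [dedekindCotangentSum, Finset.filter_true_of_mem]
  · have han : (a n : ℂ) ≠ 0 := by exact_mod_cast (ha n).ne'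
    rw [range_lift, Finset.sum_image (fun x _ y _ hxy => Nat.cast_injective hxy)]
    simp only [PS, PowerSeries.coeff_mk, Finset.prod_mul_distrib, ← Finset.mul_sum, div_pow,
      Finset.prod_div_distrib, Finset.prod_pow_eq_pow_sum, hl', pow_succ]
    field_simp
  · intro k hk j ⟨N, hN⟩
    rw [range_lift] at hk
    obtain ⟨k, hk1, rfl⟩ := Finset.mem_image.1 hk
    apply hz n j.1 j.2 k hk1
    rw [hN, Complex.sin_eq_zero_iff]
    exact ⟨N, by ring⟩
end

section
/- (Petersson–Knopp identity) Suppose a, b are relatively prime positive integers and n is a positive integer. Then Σ_{d|n} Σ_{k mod d} s((n/d)b + ka, ad) = σ(n) s(b,a), where σ(n) denotes the sum of the positive divisors of n. -/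
open Real Finset
open scoped Classical

theorem saw_add_int (x : ℝ) (q : ℤ) : sawtooth (x + q) = sawtooth x := by
  unfold sawtooth
  have h : (∃ n : ℤ, x + q = n) ↔ (∃ n : ℤ, x = n) := by
    constructor
    · rintro ⟨n, hn⟩
      exact ⟨n - q, by push_cast; linarith⟩
    · rintro ⟨n, hn⟩
      exact ⟨n + q, by push_cast; linarith⟩
  simp only [h, Int.fract_add_intCast]

theorem saw_eq (x : ℝ) (h0 : 0 ≤ x) (h1 : x < 1) :
    sawtooth x = x - 1/2 + if x = 0 then 1/2 else 0 := by
  unfold sawtooth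
  have h : (∃ n : ℤ, x = n) ↔ x = 0 := by
    constructor
    · rintro ⟨n, hn⟩
      subst hn
      have a1 : (0:ℤ) ≤ n := by exact_mod_cast h0
      have a2 : n < (1:ℤ) := by exact_mod_cast h1
      have : n = 0 := by omega
      simp [this]
    · rintro rfl
      exact ⟨0, by simp⟩
  simp only [h]
  split_ifs with hx
  · subst hx; norm_num
  · rw [Int.fract_eq_self.2 ⟨h0, h1⟩]; ring

theorem sum_block (f : ℕ → ℝ) (a N : ℕ) :
    ∑ M ∈ range (a * N), f M = ∑ j ∈ range N, ∑ r ∈ range a, f (a * j + r) := by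
  induction N with
  | zero => simp
  | succ N ih => rw [Nat.mul_succ, Finset.sum_range_add, ih, Finset.sum_range_succ]

theorem sum_range_zmod (c : ℕ) [NeZero c] (G : ZMod c → ℝ) :
    ∑ k ∈ range c, G (k : ZMod c) = ∑ z : ZMod c, G z := by
  refine Finset.sum_bij' (fun k _ => (k : ZMod c)) (fun z _ => z.val) ?_ ?_ ?_ ?_ ?_
  · simp
  · intro z _; simpa using ZMod.val_lt z
  · intro k hk; exact ZMod.val_cast_of_lt (by simpa using hk)
  · intro z _; simp
  · simp

theorem sum_affine (c : ℕ) (hc : 0 < c) (F : ℤ → ℝ) (hF : ∀ z t : ℤ, F (z + c * t) = F z)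
    (m : ℕ) (q : ℤ) (hm : Nat.Coprime m c) :
    ∑ k ∈ range c, F (k * m + q) = ∑ k ∈ range c, F k := by
  haveI : NeZero c := ⟨hc.ne'⟩
  have key : ∀ z : ℤ, F z = (fun w : ZMod c => F (w.val : ℤ)) (z : ZMod c) := by
    intro z
    simp only
    rw [ZMod.val_intCast]
    conv_lhs => rw [← Int.emod_add_mul_ediv z c]
    rw [hF]
  rw [Finset.sum_congr rfl (fun (k : ℕ) _ => key ((k : ℤ) * m + q)),
    Finset.sum_congr rfl (fun (k : ℕ) _ => key (k : ℤ))]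
  push_cast
  rw [sum_range_zmod c (fun w => F (w.val : ℤ)),
    sum_range_zmod c (fun w => F ((w * (m : ZMod c) + (q : ZMod c)).val : ℤ))]
  let u : (ZMod c)ˣ := ZMod.unitOfCoprime m hm
  exact Equiv.sum_comp ((Units.mulRight u).trans (Equiv.addRight (q : ZMod c)))
    (fun w => F (w.val : ℤ))

theorem saw_F (x : ℝ) (c : ℕ) (hc : 0 < c) (z t : ℤ) :
    sawtooth (x + ((z + c * t : ℤ) : ℝ) / c) = sawtooth (x + (z : ℝ) / c) := by
  have hc' : (c : ℝ) ≠ 0 := by exact_mod_cast hc.ne'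
  rw [← saw_add_int (x + (z : ℝ) / c) t]
  congr 1
  push_cast
  field_simp
  ring

theorem saw_mult (x : ℝ) (c : ℕ) (hc : 0 < c) :
    ∑ j ∈ range c, sawtooth (x + (j : ℝ) / c) = sawtooth (c * x) := by
  have hc' : (0 : ℝ) < c := by exact_mod_cast hc
  set q := ⌊c * x⌋ with hq
  set y := Int.fract (c * x) with hy
  have hx : c * x = y + q := by rw [hy, hq]; exact (Int.fract_add_floor _).symm
  have hy0 : 0 ≤ y := Int.fract_nonneg _
  have hy1 : y < 1 := Int.fract_lt_one _
  have hx2 : x = y / c + q / c := by field_simp; linarith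
  have h1 := sum_affine c hc (fun z => sawtooth (y / c + (z : ℝ) / c))
    (fun z t => saw_F _ c hc z t) 1 q (by simp)
  have h2 : ∑ j ∈ range c, sawtooth (x + (j : ℝ) / c)
      = ∑ j ∈ range c, sawtooth (y / c + (j : ℝ) / c) := by
    push_cast at h1
    rw [← h1]
    apply Finset.sum_congr rfl
    intro j _
    congr 1
    rw [hx2]; ring
  rw [h2, hx, saw_add_int, saw_eq y hy0 hy1]
  have h3 : ∀ j ∈ range c, sawtooth (y / c + (j : ℝ) / c)
      = (y / c - 1/2) + (j : ℝ) * (1 / c) + if j = 0 then (if y = 0 then 1/2 else 0) else 0 := by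
    intro j hj
    have hj1 : (j : ℝ) + 1 ≤ c := by exact_mod_cast (Finset.mem_range.1 hj)
    have e : y / c + (j : ℝ) / c = (y + j) / c := by ring
    have hj0 : (0 : ℝ) ≤ j := by positivity
    rw [e, saw_eq _ (by positivity) (by rw [div_lt_one hc']; linarith)]
    have e2 : ((y + j) / c = 0) ↔ (j = 0 ∧ y = 0) := by
      rw [div_eq_zero_iff]
      constructor
      · rintro (h | h)
        · have : (j : ℝ) = 0 := by linarith
          exact ⟨by exact_mod_cast this, by linarith⟩
        · exact absurd h hc'.ne'
      · rintro ⟨h1, h2⟩; left; rw [h1, h2]; simp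
    simp only [e2, ite_and]
    ring
  rw [Finset.sum_congr rfl h3, Finset.sum_add_distrib, Finset.sum_add_distrib, ← Finset.sum_mul]
  have h4 : (∑ j ∈ range c, (j : ℝ)) = c * (c - 1) / 2 := by
    have : ∀ n : ℕ, (∑ j ∈ range n, (j : ℝ)) = n * (n - 1) / 2 := by
      intro n
      induction n with
      | zero => simp
      | succ n ih => rw [Finset.sum_range_succ, ih]; push_cast; ring
    exact this c
  rw [h4, Finset.sum_ite_eq']
  simp only [Finset.mem_range, hc, if_true, Finset.sum_const, Finset.card_range, nsmul_eq_mul]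
  field_simp
  ring

theorem saw_gcd (x : ℝ) (d m : ℕ) (hd : 0 < d) :
    ∑ k ∈ range d, sawtooth (x + (k : ℝ) * m / d)
      = (Nat.gcd m d : ℝ) * sawtooth (((d / Nat.gcd m d : ℕ) : ℝ) * x) := by
  obtain ⟨g, m', d', hg, hco, hm, hd'⟩ := Nat.exists_coprime' (m := m) (n := d)
    (Nat.gcd_pos_of_pos_right _ hd)
  have hgg : Nat.gcd m d = g := by
    rw [hm, hd', Nat.gcd_mul_right, hco.gcd_eq_one, one_mul]
  rw [hgg]
  subst hm hd'
  have hd0 : 0 < d' := Nat.pos_of_mul_pos_right hd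
  have hg' : (g : ℝ) ≠ 0 := by exact_mod_cast hg.ne'
  have hdd : (d' : ℝ) ≠ 0 := by exact_mod_cast hd0.ne'
  rw [Nat.mul_div_cancel _ hg, ← saw_mult x d' hd0, sum_block]
  have h1 := sum_affine d' hd0 (fun z => sawtooth (x + (z : ℝ) / d'))
    (fun z t => saw_F _ d' hd0 z t) m' 0 hco
  push_cast at h1
  have : ∀ j ∈ range g, ∑ r ∈ range d', sawtooth (x + ((d' * j + r : ℕ) : ℝ) * ((m' * g : ℕ) : ℝ)
      / ((d' * g : ℕ) : ℝ)) = ∑ r ∈ range d', sawtooth (x + (r : ℝ) / d') := by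
    intro j _
    rw [← h1]
    apply Finset.sum_congr rfl
    intro r _
    rw [← saw_add_int (x + ((r : ℝ) * m' + 0) / d') (j * m' : ℤ)]
    congr 1
    push_cast
    field_simp
    ring
  rw [Finset.sum_congr rfl this]
  simp

theorem ded_scale (a b N : ℕ) (ha : 0 < a) (hN : 0 < N) :
    ∑ M ∈ range (a * N), sawtooth ((M : ℝ) * b / a) * sawtooth ((M : ℝ) / (a * N))
      = dedekindSum b a := by
  have ha' : (a : ℝ) ≠ 0 := by exact_mod_cast ha.ne'
  have hN' : (N : ℝ) ≠ 0 := by exact_mod_cast hN.ne'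
  rw [sum_block, Finset.sum_comm]
  unfold dedekindSum
  apply Finset.sum_congr rfl
  intro r _
  have e : (r : ℝ) / a = N * ((r : ℝ) / (a * N)) := by field_simp
  rw [e, ← saw_mult _ N hN, Finset.mul_sum]
  apply Finset.sum_congr rfl
  intro j _
  rw [← saw_add_int ((r : ℝ) * b / a) (j * b : ℤ)]
  congr 2
  · push_cast; field_simp; ring
  · push_cast; field_simp; ring

/-- The Petersson–Knopp identity:
`Σ_{d|n} Σ_{k mod d} s((n/d)b + ka, ad) = σ(n) s(b,a)` for coprime positive `a, b`. -/
theorem petersson_knopp (a b n : ℕ) (ha : 0 < a) (hb : 0 < b) (hn : 0 < n)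
    (hab : Nat.Coprime a b) :
    (∑ d ∈ n.divisors, ∑ k ∈ Finset.range d, dedekindSum ((n / d) * b + k * a) (a * d)) =
      (∑ d ∈ n.divisors, (d : ℝ)) * dedekindSum b a := by
  have ha' : (a : ℝ) ≠ 0 := by exact_mod_cast ha.ne'
  have hL : ∀ d ∈ n.divisors,
      ∑ k ∈ Finset.range d, dedekindSum ((n / d) * b + k * a) (a * d)
      = ∑ m ∈ range (a * d), (Nat.gcd m d : ℝ) *
        sawtooth (((n / d * m / Nat.gcd m d : ℕ) : ℝ) * b / a) * sawtooth ((m : ℝ) / (a * d)) := by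
    intro d hd
    have hd0 : 0 < d := Nat.pos_of_mem_divisors hd
    have hd' : (d : ℝ) ≠ 0 := by exact_mod_cast hd0.ne'
    unfold dedekindSum
    rw [Finset.sum_comm]
    apply Finset.sum_congr rfl
    intro m _
    have hg : 0 < Nat.gcd m d := Nat.gcd_pos_of_pos_right _ hd0
    have hg' : (Nat.gcd m d : ℝ) ≠ 0 := by exact_mod_cast hg.ne'
    have h := saw_gcd ((m : ℝ) * (n / d : ℕ) * b / (a * d)) d m hd0
    rw [← Finset.sum_mul]
    push_cast
    congr 1
    have e : ((d / Nat.gcd m d : ℕ) : ℝ) * ((m : ℝ) * (n / d : ℕ) * b / (a * d))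
        = ((n / d * m / Nat.gcd m d : ℕ) : ℝ) * b / a := by
      rw [Nat.cast_div (Nat.gcd_dvd_right m d) hg',
        Nat.cast_div (Dvd.dvd.mul_left (Nat.gcd_dvd_left m d) _) hg']
      push_cast
      field_simp
    rw [e] at h
    rw [← h]
    apply Finset.sum_congr rfl
    intro k _
    congr 1
    field_simp
  have hR : ∀ g ∈ n.divisors, (g : ℝ) * dedekindSum b a = ∑ M ∈ range (a * (n / g)),
      (g : ℝ) * sawtooth ((M : ℝ) * b / a) * sawtooth ((M : ℝ) / (a * (n / g : ℕ))) := by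
    intro g hg
    have : 0 < n / g := Nat.div_pos (Nat.divisor_le hg) (Nat.pos_of_mem_divisors hg)
    rw [← ded_scale a b (n / g) ha this, Finset.mul_sum]
    simp only [mul_assoc]
  rw [Finset.sum_mul, Finset.sum_congr rfl hL, Finset.sum_congr rfl hR, Finset.sum_sigma',
    Finset.sum_sigma']
  have fwd : ∀ d m : ℕ, d ∣ n → m < a * d → ∃ g e m' d', 0 < g ∧ 0 < e ∧ 0 < d' ∧
      Nat.Coprime m' d' ∧ m = m' * g ∧ d = d' * g ∧ n = d' * g * e ∧ Nat.gcd m d = g ∧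
      m' < a * d' := by
    intro d m hd hm
    have hd0 := Nat.pos_of_dvd_of_pos hd hn
    obtain ⟨g, m', d', hg, hco, hm', hd'⟩ := Nat.exists_coprime' (m := m) (n := d)
      (Nat.gcd_pos_of_pos_right _ hd0)
    obtain ⟨e, he⟩ := hd
    refine ⟨g, e, m', d', hg, ?_, ?_, hco, hm', hd', ?_, ?_, ?_⟩
    · rcases Nat.eq_zero_or_pos e with h | h
      · subst h; omega
      · exact h
    · rcases Nat.eq_zero_or_pos d' with h | h
      · subst h; omega
      · exact h
    · rw [he, hd']
    · rw [hm', hd', Nat.gcd_mul_right, hco.gcd_eq_one, one_mul]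
    · rw [hm', hd', ← mul_assoc] at hm
      exact Nat.lt_of_mul_lt_mul_right hm
  have bwd : ∀ g M : ℕ, g ∣ n → M < a * (n / g) → ∃ e m' d', 0 < g ∧ 0 < e ∧ 0 < d' ∧
      Nat.Coprime m' d' ∧ M = m' * e ∧ n / g = d' * e ∧ n = d' * g * e ∧ Nat.gcd M (n / g) = e ∧
      m' < a * d' := by
    intro g M hg hM
    have hg0 := Nat.pos_of_dvd_of_pos hg hn
    obtain ⟨e, g', m', d', he, hg', hd', hco, h1, h2, h3, h4, h5⟩ :=
      fwd (n / g) M (Nat.div_dvd_of_dvd hg) hM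
    refine ⟨e, m', d', hg0, he, hd', hco, h1, h2, ?_, h4, h5⟩
    have := Nat.div_mul_cancel hg
    rw [h2] at this
    rw [← this]; ring
  refine Finset.sum_bij'
    (fun p _ => ⟨Nat.gcd p.2 p.1, n / p.1 * p.2 / Nat.gcd p.2 p.1⟩)
    (fun p _ => ⟨n / Nat.gcd p.2 (n / p.1), p.2 * p.1 / Nat.gcd p.2 (n / p.1)⟩) ?_ ?_ ?_ ?_ ?_
  · rintro ⟨d, m⟩ hp
    simp only [Finset.mem_sigma, Nat.mem_divisors, Finset.mem_range] at hp ⊢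
    obtain ⟨g, e, m', d', hg, he, hd', hco, rfl, rfl, hN, hgcd, hlt⟩ := fwd d m hp.1.1 hp.2
    rw [hgcd]
    have e1 : n / (d' * g) = e := by rw [hN]; exact Nat.mul_div_cancel_left _ (by positivity)
    have e2 : n / g = d' * e := by
      rw [hN, show d' * g * e = d' * e * g by ring]; exact Nat.mul_div_cancel _ hg
    have e3 : e * (m' * g) / g = e * m' := by
      rw [← mul_assoc]; exact Nat.mul_div_cancel _ hg
    rw [e1, e2, e3]
    refine ⟨⟨⟨d' * e, by rw [hN]; ring⟩, hn.ne'⟩, ?_⟩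
    nlinarith
  · rintro ⟨g, M⟩ hp
    simp only [Finset.mem_sigma, Nat.mem_divisors, Finset.mem_range] at hp ⊢
    obtain ⟨e, m', d', hg, he, hd', hco, hM, hng, hN, hgcd, hlt⟩ := bwd g M hp.1.1 hp.2
    rw [hgcd, hM]
    have e1 : n / e = d' * g := by rw [hN]; exact Nat.mul_div_cancel _ he
    have e3 : m' * e * g / e = m' * g := by
      rw [show m' * e * g = m' * g * e by ring]; exact Nat.mul_div_cancel _ he
    rw [e1, e3]
    refine ⟨⟨⟨e, hN⟩, hn.ne'⟩, ?_⟩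
    nlinarith
  · rintro ⟨d, m⟩ hp
    simp only [Finset.mem_sigma, Nat.mem_divisors, Finset.mem_range] at hp ⊢
    obtain ⟨g, e, m', d', hg, he, hd', hco, rfl, rfl, hN, hgcd, hlt⟩ := fwd d m hp.1.1 hp.2
    rw [hgcd]
    have e1 : n / (d' * g) = e := by rw [hN]; exact Nat.mul_div_cancel_left _ (by positivity)
    have e2 : n / g = d' * e := by
      rw [hN, show d' * g * e = d' * e * g by ring]; exact Nat.mul_div_cancel _ hg
    have e3 : e * (m' * g) / g = m' * e := by
      rw [show e * (m' * g) = m' * e * g by ring]; exact Nat.mul_div_cancel _ hg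
    have e4 : Nat.gcd (m' * e) (d' * e) = e := by
      rw [Nat.gcd_mul_right, hco.gcd_eq_one, one_mul]
    have e5 : n / e = d' * g := by rw [hN]; exact Nat.mul_div_cancel _ he
    have e6 : m' * e * g / e = m' * g := by
      rw [show m' * e * g = m' * g * e by ring]; exact Nat.mul_div_cancel _ he
    rw [e1, e2, e3, e4, e5, e6]
  · rintro ⟨g, M⟩ hp
    simp only [Finset.mem_sigma, Nat.mem_divisors, Finset.mem_range] at hp ⊢
    obtain ⟨e, m', d', hg, he, hd', hco, hM, hng, hN, hgcd, hlt⟩ := bwd g M hp.1.1 hp.2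
    rw [hgcd, hM]
    have e1 : n / e = d' * g := by rw [hN]; exact Nat.mul_div_cancel _ he
    have e3 : m' * e * g / e = m' * g := by
      rw [show m' * e * g = m' * g * e by ring]; exact Nat.mul_div_cancel _ he
    have e4 : Nat.gcd (m' * g) (d' * g) = g := by
      rw [Nat.gcd_mul_right, hco.gcd_eq_one, one_mul]
    have e5 : n / (d' * g) = e := by rw [hN]; exact Nat.mul_div_cancel_left _ (by positivity)
    have e6 : e * (m' * g) / g = m' * e := by
      rw [show e * (m' * g) = m' * e * g by ring]; exact Nat.mul_div_cancel _ hg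
    rw [e1, e3, e4, e5, e6]
  · rintro ⟨d, m⟩ hp
    simp only [Finset.mem_sigma, Nat.mem_divisors, Finset.mem_range] at hp ⊢
    obtain ⟨g, e, m', d', hg, he, hd', hco, rfl, rfl, hN, hgcd, hlt⟩ := fwd d m hp.1.1 hp.2
    rw [hgcd]
    have e1 : n / (d' * g) = e := by rw [hN]; exact Nat.mul_div_cancel_left _ (by positivity)
    have e2 : n / g = d' * e := by
      rw [hN, show d' * g * e = d' * e * g by ring]; exact Nat.mul_div_cancel _ hg
    have e3 : e * (m' * g) / g = m' * e := by
      rw [show e * (m' * g) = m' * e * g by ring]; exact Nat.mul_div_cancel _ hg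
    rw [e1, e2, e3]
    have r1 : (g : ℝ) ≠ 0 := by exact_mod_cast hg.ne'
    have r2 : (e : ℝ) ≠ 0 := by exact_mod_cast he.ne'
    have r3 : (d' : ℝ) ≠ 0 := by exact_mod_cast hd'.ne'
    congr 2
    push_cast
    field_simp
end

section
/- For every integer m ≥ 2, every positive integer p, and every integer n, the Bernoulli function satisfies B̄_m(n/p) = B_m/(−p)^m + m (i/(2p))^m Σ_{k=1}^{p−1} cot^{(m−1)}(πk/p) e^{2πikn/p}. -/
open Real Finset
open scoped Classical

/-- The Bernoulli function `B̄_k(x) = B_k({x})`: the `k`-th Bernoulli polynomial evaluated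
at the fractional part of `x`. -/
noncomputable def bernoulliFunc (k : ℕ) (x : ℝ) : ℝ :=
  Polynomial.aeval (Int.fract x) (Polynomial.bernoulli k)

lemma bff_iter_comp (f : ℂ → ℂ) (c : ℂ) (n : ℕ) :
    iteratedDeriv n (fun x => f (c * x)) = fun x => c ^ n * iteratedDeriv n f (c * x) := by
  induction n with
  | zero => simp
  | succ n ih =>
    rw [iteratedDeriv_succ, ih]
    funext x
    rw [deriv_const_mul_field, deriv_comp_mul_left, iteratedDeriv_succ, smul_eq_mul, pow_succ,
      mul_assoc]

lemma bff_cot_upper (k : ℕ) (hk : 1 ≤ k) (z : ℂ) (hz : 0 < z.im) :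
    (Real.pi : ℂ) ^ (k + 1) * iteratedDeriv k Complex.cot (Real.pi * z) =
      (-1) ^ k * (k.factorial : ℂ) * ∑' n : ℤ, 1 / (z + n) ^ (k + 1) := by
  have h := iteratedDerivWithin_cot_pi_mul_eq_mul_tsum_div_pow hk (z := z) hz
  rw [iteratedDerivWithin_of_isOpen UpperHalfPlane.isOpen_upperHalfPlaneSet hz,
    iteratedDeriv_const_mul_field, bff_iter_comp] at h
  rw [← h]; ring

lemma bff_cot_analytic (z : ℂ) (hz : Complex.sin z ≠ 0) : AnalyticAt ℂ Complex.cot z := by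
  have : Complex.cot = fun z => Complex.cos z / Complex.sin z := by
    funext z; rw [Complex.cot]
  rw [this]
  exact (Complex.analyticAt_cos).div (Complex.analyticAt_sin) hz

lemma bff_summable (k : ℕ) (hk : 1 ≤ k) (z : ℂ) :
    Summable (fun n : ℤ => 1 / (z + n) ^ (k + 1)) := by
  have := EisensteinSeries.linear_right_summable z 1 (k := (k + 1 : ℕ)) (by push_cast; omega)
  simpa only [Int.cast_one, one_mul, zpow_natCast, one_div] using this

lemma bff_cot_real (k : ℕ) (hk : 1 ≤ k) (x : ℝ) (hx : ∀ n : ℤ, x ≠ n) :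
    (Real.pi : ℂ) ^ (k + 1) * iteratedDeriv k Complex.cot (Real.pi * x) =
      (-1) ^ k * (k.factorial : ℂ) * ∑' n : ℤ, 1 / ((x : ℂ) + n) ^ (k + 1) := by
  have hpath : Filter.Tendsto (fun t : ℝ => (x : ℂ) + t * Complex.I)
      (nhdsWithin 0 (Set.Ioi 0)) (nhds (x : ℂ)) := by
    have : Continuous (fun t : ℝ => (x : ℂ) + t * Complex.I) := by fun_prop
    have h := (this.tendsto 0).mono_left (nhdsWithin_le_nhds (s := Set.Ioi 0))
    simpa using h
  have hsin : Complex.sin (Real.pi * x) ≠ 0 := by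
    apply sin_pi_mul_ne_zero
    rintro ⟨n, hn⟩
    exact hx n (by exact_mod_cast hn.symm)
  have hcont : ContinuousAt (iteratedDeriv k Complex.cot) (Real.pi * x) := by
    rw [iteratedDeriv_eq_iterate]
    exact ((bff_cot_analytic _ hsin).iterated_deriv k).continuousAt
  have h1 : Filter.Tendsto (fun t : ℝ => (Real.pi : ℂ) ^ (k + 1) *
      iteratedDeriv k Complex.cot (Real.pi * ((x : ℂ) + t * Complex.I)))
      (nhdsWithin 0 (Set.Ioi 0))
      (nhds ((Real.pi : ℂ) ^ (k + 1) * iteratedDeriv k Complex.cot (Real.pi * x))) :=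
    (hcont.tendsto.comp (hpath.const_mul _)).const_mul _
  have h2 : Filter.Tendsto (fun t : ℝ => (-1) ^ k * (k.factorial : ℂ) *
      ∑' n : ℤ, 1 / ((x : ℂ) + t * Complex.I + n) ^ (k + 1))
      (nhdsWithin 0 (Set.Ioi 0))
      (nhds ((-1) ^ k * (k.factorial : ℂ) * ∑' n : ℤ, 1 / ((x : ℂ) + n) ^ (k + 1))) := by
    apply Filter.Tendsto.const_mul
    refine tendsto_tsum_of_dominated_convergence (bff_summable k hk x).norm ?_ ?_
    · intro n
      have hne : (x : ℂ) + n ≠ 0 := by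
        intro h
        apply hx (-n)
        have : ((x + n : ℝ) : ℂ) = 0 := by push_cast; exact h
        have : x + n = 0 := by exact_mod_cast this
        push_cast; linarith
      exact Filter.Tendsto.div tendsto_const_nhds ((hpath.add_const _).pow _) (pow_ne_zero _ hne)
    · refine Filter.Eventually.of_forall fun t n => ?_
      have hne : 0 < ‖(x : ℂ) + n‖ := by
        rw [norm_pos_iff]
        intro h
        apply hx (-n)
        have : ((x + n : ℝ) : ℂ) = 0 := by push_cast; exact h
        have : x + n = 0 := by exact_mod_cast this
        push_cast; linarith
      have hle : ‖(x : ℂ) + n‖ ≤ ‖(x : ℂ) + t * Complex.I + n‖ := by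
        have h := Complex.abs_re_le_norm ((x : ℂ) + t * Complex.I + n)
        have e : ‖(x : ℂ) + n‖ = |x + n| := by
          rw [← Real.norm_eq_abs, ← Complex.norm_real]; push_cast; rfl
        rw [e]
        simpa using h
      rw [norm_div, norm_div, norm_pow, norm_pow]
      gcongr
  refine tendsto_nhds_unique (h1.congr' ?_) h2
  filter_upwards [self_mem_nhdsWithin] with t ht
  exact bff_cot_upper k hk _ (by simpa using ht)

/-- Discrete Fourier expansion of the Bernoulli functions. -/
theorem bernoulliFunc_fourier (m : ℕ) (hm : 2 ≤ m) (p : ℕ) (hp : 0 < p) (n : ℤ) :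
    (bernoulliFunc m ((n : ℝ) / p) : ℂ) =
      ((bernoulli m : ℚ) : ℂ) / (-(p : ℂ)) ^ m +
        (m : ℂ) * (Complex.I / (2 * p)) ^ m *
          ∑ k ∈ Finset.Icc 1 (p - 1),
            iteratedDeriv (m - 1) Complex.cot ((Real.pi : ℂ) * k / p) *
              Complex.exp (2 * Real.pi * Complex.I * k * n / p) := by
  have : NeZero p := ⟨hp.ne'⟩
  have hpC : (p : ℂ) ≠ 0 := by exact_mod_cast hp.ne'
  have hpi : (Real.pi : ℂ) ≠ 0 := by exact_mod_cast Real.pi_ne_zero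
  obtain ⟨q, rfl⟩ : ∃ q, m = q + 1 := ⟨m - 1, by omega⟩
  have hq : 1 ≤ q := by omega
  simp only [Nat.add_sub_cancel]
  set E : ℕ → ℂ := fun k => Complex.exp (2 * Real.pi * Complex.I * k * n / p) with hE
  set x : ℝ := Int.fract ((n : ℝ) / p) with hx
  have hB : bernoulliFunc (q + 1) ((n : ℝ) / p) = bernoulliFun (q + 1) x := by
    rw [bernoulliFunc, bernoulliFun, Polynomial.eval_map_algebraMap]
  have H := hasSum_one_div_pow_mul_fourier_mul_bernoulliFun hm (x := x)
    ⟨Int.fract_nonneg _, (Int.fract_lt_one _).le⟩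
  have H0 := hasSum_one_div_pow_mul_fourier_mul_bernoulliFun hm (x := 0)
    ⟨le_refl _, zero_le_one⟩
  rw [bernoulliFun_eval_zero] at H0
  set C : ℂ := -(2 * Real.pi * Complex.I) ^ (q + 1) / ((q + 1).factorial : ℂ) with hC
  have hC0 : C ≠ 0 := by
    rw [hC]
    refine div_ne_zero (neg_ne_zero.mpr (pow_ne_zero _ ?_)) ?_
    · simp [Real.pi_ne_zero]
    · exact_mod_cast Nat.factorial_ne_zero _
  let T : ℕ → ℂ := fun k => if k = 0 then C * ((bernoulli (q + 1) : ℚ) : ℂ) / p ^ (q + 1) else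
    (Real.pi : ℂ) ^ (q + 1) * (-1) ^ q / (q.factorial : ℂ) / p ^ (q + 1) *
      (iteratedDeriv q Complex.cot ((Real.pi : ℂ) * k / p) * E k)
  have hfour : ∀ (l : ℤ) (k : ℕ), fourier (l * p + k) (x : AddCircle (1 : ℝ)) = E k := by
    intro l k
    rw [fourier_coe_apply, hE]
    simp only
    rw [Complex.exp_eq_exp_iff_exists_int]
    refine ⟨l * n - (l * p + k) * ⌊(n : ℝ) / p⌋, ?_⟩
    have : (x : ℂ) = (n : ℂ) / p - (⌊(n : ℝ) / p⌋ : ℤ) := by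
      rw [hx, Int.fract]; push_cast; rfl
    rw [this]
    push_cast
    field_simp
    ring
  have H' := (Int.divModEquiv p).symm.hasSum_iff.mpr H
  have H'' := (Equiv.prodComm (Fin p) ℤ).hasSum_iff.mpr H'
  have hfib : ∀ k : Fin p, HasSum (fun l : ℤ =>
      (((fun j : ℤ => 1 / (j : ℂ) ^ (q + 1) * fourier j (x : AddCircle (1 : ℝ))) ∘
        (Int.divModEquiv p).symm) ∘ (Equiv.prodComm (Fin p) ℤ)) (k, l)) (T k) := by
    intro k
    simp only [Function.comp, Equiv.prodComm_apply, Prod.swap, Int.divModEquiv_symm_apply]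
    simp only [hfour]
    by_cases hk : (k : ℕ) = 0
    · simp only [T, hk, if_true]
      have hE0 : E 0 = 1 := by simp [hE]
      rw [hE0]
      have := H0.div_const ((p : ℂ) ^ (q + 1))
      convert! this using 1
      · funext l
        rw [fourier_coe_apply]
        push_cast
        simp [mul_pow, div_eq_mul_inv, mul_comm]
    · simp only [T, hk, if_false]
      have hkx : ∀ j : ℤ, ((k : ℕ) / p : ℝ) ≠ j := by
        intro j hj
        have hpR : (0 : ℝ) < p := by exact_mod_cast hp
        have hj2 : ((k : ℕ) : ℝ) = j * p := by rw [← hj]; field_simp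
        have hj3 : ((k : ℕ) : ℤ) = j * p := by exact_mod_cast hj2
        have hkl : ((k : ℕ) : ℤ) < p := by exact_mod_cast k.2
        have hk0 : 0 < ((k : ℕ) : ℤ) := by omega
        have hpZ : (0 : ℤ) < p := by exact_mod_cast hp
        have j0 : 0 < j := by
          by_contra h
          push Not at h
          nlinarith
        nlinarith
      have hc := bff_cot_real q hq ((k : ℕ) / p) hkx
      have hs := (bff_summable q hq (((k : ℕ) / p : ℝ) : ℂ)).hasSum
      have hs2 := (hs.div_const ((p : ℂ) ^ (q + 1))).mul_right (E k)
      have hfq : (q.factorial : ℂ) ≠ 0 := by exact_mod_cast Nat.factorial_ne_zero _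
      convert! hs2 using 1
      · funext l
        congr 1
        rw [div_div, ← mul_pow]
        congr 2
        push_cast
        field_simp
        ring
      · have harg : (Real.pi : ℂ) * (k : ℕ) / p = Real.pi * (((k : ℕ) / p : ℝ) : ℂ) := by
          push_cast; ring
        have h1 : ((-1 : ℂ) ^ q) * (-1) ^ q = 1 := by
          rw [← mul_pow]; simp
        have : ∑' n : ℤ, 1 / ((((k : ℕ) / p : ℝ) : ℂ) + n) ^ (q + 1) =
            (-1) ^ q * ((Real.pi : ℂ) ^ (q + 1) *
              iteratedDeriv q Complex.cot (Real.pi * (((k : ℕ) / p : ℝ) : ℂ))) /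
              (q.factorial : ℂ) := by
          rw [hc, eq_div_iff hfq]
          linear_combination (-(∑' n : ℤ, 1 / ((((k : ℕ) / p : ℝ) : ℂ) + n) ^ (q + 1)) *
            (q.factorial : ℂ)) * h1
        rw [this, harg]
        ring
  have hfin := (H''.prod_fiberwise hfib).unique (hasSum_fintype _)
  rw [Fin.sum_univ_eq_sum_range T p] at hfin
  have hr : Finset.range p = insert 0 (Finset.Icc 1 (p - 1)) := by
    ext a; simp only [Finset.mem_range, Finset.mem_insert, Finset.mem_Icc]; omega
  rw [hr, Finset.sum_insert (by simp)] at hfin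
  have hsum : ∑ k ∈ Finset.Icc 1 (p - 1), T k =
      (Real.pi : ℂ) ^ (q + 1) * (-1) ^ q / (q.factorial : ℂ) / p ^ (q + 1) *
      ∑ k ∈ Finset.Icc 1 (p - 1),
        (iteratedDeriv q Complex.cot ((Real.pi : ℂ) * k / p) * E k) := by
    rw [Finset.mul_sum]
    refine Finset.sum_congr rfl fun k hk => ?_
    have : k ≠ 0 := by have := (Finset.mem_Icc.mp hk).1; omega
    simp only [T, this, if_false]
  have hT0 : T 0 = C * ((bernoulli (q + 1) : ℚ) : ℂ) / p ^ (q + 1) := by simp [T]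
  rw [hsum, hT0] at hfin
  have hsign : ((bernoulli (q + 1) : ℚ) : ℂ) / (-(p : ℂ)) ^ (q + 1) =
      ((bernoulli (q + 1) : ℚ) : ℂ) / (p : ℂ) ^ (q + 1) := by
    rcases Nat.even_or_odd (q + 1) with h | h
    · rw [h.neg_pow]
    · rw [bernoulli_eq_zero_of_odd h (by omega)]; simp
  have hcoef : (Real.pi : ℂ) ^ (q + 1) * (-1) ^ q / (q.factorial : ℂ) / p ^ (q + 1) =
      C * (((q + 1 : ℕ) : ℂ) * (Complex.I / (2 * p)) ^ (q + 1)) := by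
    have hfq : (q.factorial : ℂ) ≠ 0 := by exact_mod_cast Nat.factorial_ne_zero _
    have hq1 : ((q : ℂ) + 1) ≠ 0 := by exact_mod_cast Nat.succ_ne_zero q
    have hI : Complex.I ^ (q + 1) * Complex.I ^ (q + 1) = (-1) ^ (q + 1) := by
      rw [← mul_pow, Complex.I_mul_I]
    rw [hC, Nat.factorial_succ, div_pow, mul_pow, mul_pow, mul_pow]
    push_cast
    field_simp
    rw [← pow_mul, mul_comm (q + 1) 2, pow_mul, Complex.I_sq]
    ring
  rw [hB, hsign]
  apply mul_left_cancel₀ hC0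
  rw [hfin, hcoef]
  ring
end

section
/- If a, b, c are pairwise relatively prime positive integers and m, n ≥ 2 are integers with the same parity, then the Dedekind Bernoulli sum satisfies s_{m,n}(a;b,c) = mn (−1)^{(m−n)/2} / 2^{m+n} · (1/a^{m+n−1}) Σ_{k=1}^{a−1} cot^{(m−1)}(πkc/a) cot^{(n−1)}(πkb/a) + B_m B_n / a^{m+n−1}. -/
open Real Finset
open scoped Classical

/-- The Dedekind Bernoulli sum `s_{m,n}(a;b,c) = Σ_{k mod a} B̄_m(kb/a) B̄_n(kc/a)`. -/
noncomputable def dedekindBernoulliSum (m n a b c : ℕ) : ℝ :=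
  ∑ k ∈ Finset.range a, bernoulliFunc m (k * b / a) * bernoulliFunc n (k * c / a)

lemma iterDeriv_comp_mul_aux (f : ℂ → ℂ) (c : ℂ) (k : ℕ) :
    iteratedDeriv k (fun x => f (c * x)) = fun x => c ^ k * iteratedDeriv k f (c * x) := by
  induction k with
  | zero => simp
  | succ k ih =>
    funext x
    rw [iteratedDeriv_succ, ih, deriv_const_mul_field, deriv_comp_mul_left,
      iteratedDeriv_succ, smul_eq_mul]
    ring

lemma cot_upper_aux (k : ℕ) (hk : 1 ≤ k) (z : ℂ) (hz : 0 < z.im) :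
    (π : ℂ) ^ (k + 1) * iteratedDeriv k Complex.cot (π * z) =
      (-1) ^ k * (k.factorial : ℂ) * ∑' n : ℤ, 1 / (z + n) ^ (k + 1) := by
  have h := iteratedDerivWithin_cot_pi_mul_eq_mul_tsum_div_pow hk (z := z) hz
  rw [iteratedDerivWithin_of_isOpen UpperHalfPlane.isOpen_upperHalfPlaneSet hz,
    iteratedDeriv_const_mul_field, iterDeriv_comp_mul_aux] at h
  rw [← h]; ring

lemma cot_analytic_aux (z : ℂ) (hz : Complex.sin z ≠ 0) (k : ℕ) :
    ContinuousAt (iteratedDeriv k Complex.cot) z := by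
  rw [iteratedDeriv_eq_iterate]
  apply AnalyticAt.continuousAt (𝕜 := ℂ)
  apply AnalyticAt.iterated_deriv
  have : Complex.cot = fun z => Complex.cos z / Complex.sin z := by
    funext z; exact Complex.cot_eq_cos_div_sin z
  rw [this]
  exact AnalyticAt.fun_div (Complex.analyticAt_cos) (Complex.analyticAt_sin) hz

lemma cot_real_aux (k : ℕ) (hk : 1 ≤ k) (x : ℝ) (hx : ∀ n : ℤ, x ≠ n) :
    (π : ℂ) ^ (k + 1) * iteratedDeriv k Complex.cot (π * x) =
      (-1) ^ k * (k.factorial : ℂ) * ∑' n : ℤ, 1 / ((x : ℂ) + n) ^ (k + 1) := by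
  have hxn : ∀ n : ℤ, (x : ℝ) + n ≠ 0 := fun n h => hx (-n) (by push_cast; linarith)
  have hsin : Complex.sin (π * x) ≠ 0 := by
    apply sin_pi_mul_ne_zero
    rintro ⟨n, hn⟩
    exact hx n (by exact_mod_cast hn.symm)
  have hpath : Filter.Tendsto (fun y : ℝ => (x : ℂ) + y * Complex.I)
      (nhdsWithin 0 (Set.Ioi 0)) (nhds (x : ℂ)) := by
    apply Filter.Tendsto.mono_left _ nhdsWithin_le_nhds
    have : Continuous (fun y : ℝ => (x : ℂ) + y * Complex.I) := by fun_prop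
    simpa using this.tendsto 0
  have h1 : Filter.Tendsto (fun y : ℝ => (π : ℂ) ^ (k + 1) *
      iteratedDeriv k Complex.cot (π * ((x : ℂ) + y * Complex.I)))
      (nhdsWithin 0 (Set.Ioi 0)) (nhds ((π : ℂ) ^ (k + 1) *
        iteratedDeriv k Complex.cot (π * x))) :=
    ((cot_analytic_aux _ hsin k).tendsto.comp (hpath.const_mul _)).const_mul _
  have h2 : Filter.Tendsto (fun y : ℝ => (-1 : ℂ) ^ k * (k.factorial : ℂ) *
      ∑' n : ℤ, 1 / ((x : ℂ) + y * Complex.I + n) ^ (k + 1))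
      (nhdsWithin 0 (Set.Ioi 0)) (nhds ((-1 : ℂ) ^ k * (k.factorial : ℂ) *
        ∑' n : ℤ, 1 / ((x : ℂ) + n) ^ (k + 1))) := by
    apply Filter.Tendsto.const_mul
    apply tendsto_tsum_of_dominated_convergence
      (bound := fun n : ℤ => ‖1 / ((x : ℂ) + n) ^ (k + 1)‖)
    · apply Summable.norm
      have := EisensteinSeries.linear_right_summable (x : ℂ) 1 (k := k + 1) (by lia)
      refine this.congr fun n => ?_
      simp only [Int.cast_one, one_mul, one_div]
      norm_cast
    · intro n
      have h0 : (x : ℂ) + n ≠ 0 := by exact_mod_cast hxn n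
      exact tendsto_const_nhds.div ((hpath.add_const _).pow _) (pow_ne_zero _ h0)
    · refine Filter.Eventually.of_forall fun y n => ?_
      have h0 : 0 < ‖(x : ℂ) + n‖ := norm_pos_iff.2 (by exact_mod_cast hxn n)
      have h3 : ‖(x : ℂ) + n‖ ≤ ‖(x : ℂ) + y * Complex.I + n‖ := by
        have e1 : ((x : ℂ) + y * Complex.I + n).re = x + n := by simp
        have e2 : ‖(x : ℂ) + n‖ = |x + n| := by
          rw [← Real.norm_eq_abs, ← Complex.norm_real]; push_cast; rfl
        rw [e2, ← e1]; exact Complex.abs_re_le_norm _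
      rw [norm_div, norm_div, norm_pow, norm_pow]
      gcongr
  refine tendsto_nhds_unique h1 (h2.congr' ?_)
  filter_upwards [self_mem_nhdsWithin] with y hy
  rw [cot_upper_aux k hk]
  simpa using hy
lemma HasSum.congr_aux_ {f g : ℤ → ℂ} {x : ℂ} (h : HasSum f x) (e : ∀ l, g l = f l) :
    HasSum g x := by
  rwa [show g = f from funext e]

/-- residue class sums -/
noncomputable def resSum (a m : ℕ) (r : ZMod a) : ℂ :=
  ∑' l : ℤ, if (l : ZMod a) = r then 1 / (l : ℂ) ^ m else 0

lemma summable_pow_aux (m : ℕ) (hm : 2 ≤ m) : Summable (fun l : ℤ => 1 / (l : ℂ) ^ m) := by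
  have := (Real.summable_one_div_int_pow (p := m)).2 (by lia)
  have := Complex.ofRealCLM.summable this
  simpa using this

lemma hasSum_resSum (a m : ℕ) (hm : 2 ≤ m) (r : ZMod a) :
    HasSum (fun l : ℤ => if (l : ZMod a) = r then 1 / (l : ℂ) ^ m else 0) (resSum a m r) := by
  apply Summable.hasSum
  refine ((summable_pow_aux m hm).indicator {l : ℤ | (l : ZMod a) = r}).congr fun l => ?_
  simp [Set.indicator_apply]

lemma resSum_neg (a m : ℕ) (r : ZMod a) : resSum a m (-r) = (-1) ^ m * resSum a m r := by
  unfold resSum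
  rw [← tsum_mul_left, ← (Equiv.neg ℤ).tsum_eq]
  congr 1
  funext l
  simp only [Equiv.neg_apply, Int.cast_neg, neg_inj, mul_ite, mul_zero]
  split_ifs with h
  · rw [neg_pow (l : ℂ) m, one_div, mul_inv, one_div]
    congr 1
    rcases neg_one_pow_eq_or ℂ m with h | h <;> rw [h] <;> norm_num
  · rfl

lemma resSum_int (a m : ℕ) (ha : 0 < a) (k : ℤ) :
    resSum a m (k : ZMod a) = ∑' t : ℤ, 1 / ((k : ℂ) + a * t) ^ m := by
  unfold resSum
  have hinj : Function.Injective (fun t : ℤ => k + a * t) := by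
    intro s t h
    simpa [ha.ne'] using h
  rw [← hinj.tsum_eq]
  · congr 1; funext t; simp
  · intro l hl
    have : (l : ZMod a) = k := by
      by_contra h
      simp [h] at hl
    rw [eq_comm, ZMod.intCast_eq_intCast_iff_dvd_sub] at this
    obtain ⟨t, ht⟩ := this
    exact ⟨t, by simp only; lia⟩

lemma resSum_cot (a m : ℕ) (ha : 0 < a) (hm : 2 ≤ m) (k : ℤ) (hk : (k : ZMod a) ≠ 0) :
    resSum a m (k : ZMod a) = (-1) ^ (m - 1) / ((m - 1).factorial : ℂ) * (π / a) ^ m *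
      iteratedDeriv (m - 1) Complex.cot (π * k / a) := by
  have ha' : (a : ℂ) ≠ 0 := by exact_mod_cast ha.ne'
  have h := cot_real_aux (m - 1) (by lia) ((k : ℝ) / a) (by
    intro n hn
    apply hk
    rw [div_eq_iff (by exact_mod_cast ha.ne')] at hn
    have : k = n * a := by exact_mod_cast hn
    simp [this])
  rw [resSum_int a m ha, show m - 1 + 1 = m by lia] at *
  have e : ∀ t : ℤ, 1 / ((k : ℂ) + a * t) ^ m =
      (1 / (a : ℂ) ^ m) * (1 / ((((k : ℝ) / a : ℝ) : ℂ) + t) ^ m) := by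
    intro t
    rw [div_mul_div_comm, one_mul, ← mul_pow]
    congr 2
    push_cast
    field_simp
  simp_rw [e]
  rw [tsum_mul_left]
  have h5 : (π : ℂ) * (((k : ℝ) / a : ℝ) : ℂ) = π * k / a := by push_cast; ring
  rw [h5] at h
  have hf : ((m - 1).factorial : ℂ) ≠ 0 := by exact_mod_cast Nat.factorial_ne_zero _
  have hs : ((-1 : ℂ) ^ (m - 1)) * (-1) ^ (m - 1) = 1 := by
    rw [← mul_pow]; norm_num
  rw [div_pow]
  field_simp
  rw [mul_assoc, h]
  linear_combination (-((m - 1).factorial : ℂ) *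
    ∑' n : ℤ, 1 / ((((k : ℝ) / a : ℝ) : ℂ) + n) ^ m) * hs

/-- the constant -/
noncomputable def bK (m : ℕ) : ℂ := -(2 * π * Complex.I) ^ m / (m.factorial : ℂ)

lemma bK_ne (m : ℕ) : bK m ≠ 0 := by
  unfold bK
  have := Complex.two_pi_I_ne_zero
  have hf : (m.factorial : ℂ) ≠ 0 := by exact_mod_cast Nat.factorial_ne_zero _
  exact div_ne_zero (neg_ne_zero.2 (pow_ne_zero _ this)) hf

lemma bernoulliFunc_fourier_s7 (m : ℕ) (hm : 2 ≤ m) (x : ℝ) :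
    HasSum (fun l : ℤ => 1 / (l : ℂ) ^ m * Complex.exp (2 * π * Complex.I * l * x))
      (bK m * bernoulliFunc m x) := by
  have h := hasSum_one_div_pow_mul_fourier_mul_bernoulliFun hm (x := Int.fract x)
    ⟨Int.fract_nonneg x, (Int.fract_lt_one x).le⟩
  have e : bernoulliFunc m x = bernoulliFun m (Int.fract x) := by
    simp [bernoulliFunc, bernoulliFun, Polynomial.aeval_def, Polynomial.eval_map]
  rw [e]
  refine HasSum.congr_aux_ h ?_
  intro l
  rw [fourier_coe_apply]
  congr 1
  rw [Complex.exp_eq_exp_iff_exists_int]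
  refine ⟨l * ⌊x⌋, ?_⟩
  have : (x : ℂ) = (Int.fract x : ℝ) + (⌊x⌋ : ℂ) := by
    have := Int.fract_add_floor x
    exact_mod_cast this.symm
  rw [this]
  push_cast
  ring

lemma bernoulliFunc_zmod (a m : ℕ) [NeZero a] (hm : 2 ≤ m) (j : ℤ) :
    bK m * bernoulliFunc m ((j : ℝ) / a) =
      ∑ r : ZMod a, ZMod.stdAddChar ((j : ZMod a) * r) * resSum a m r := by
  have ha : (a : ℂ) ≠ 0 := by exact_mod_cast NeZero.ne a
  have h1 := bernoulliFunc_fourier_s7 m hm ((j : ℝ) / a)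
  have h2 := hasSum_sum (s := Finset.univ) (fun (r : ZMod a) _ =>
    (hasSum_resSum a m hm r).mul_left (ZMod.stdAddChar ((j : ZMod a) * r)))
  refine h1.unique (HasSum.congr_aux_ h2 ?_)
  intro l
  simp only [mul_ite, mul_zero, Finset.sum_ite_eq, Finset.mem_univ, if_true]
  rw [← Int.cast_mul, ZMod.stdAddChar_coe, mul_comm]
  congr 2
  push_cast
  ring

lemma resSum_zero (a m : ℕ) (ha : 0 < a) (hm : 2 ≤ m) :
    resSum a m 0 = bK m * ((bernoulli m : ℚ) : ℂ) / (a : ℂ) ^ m := by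
  have h := (bernoulliFunc_fourier_s7 m hm 0).tsum_eq
  have e : bernoulliFunc m 0 = ((bernoulli m : ℚ) : ℝ) := by
    rw [← bernoulliFun_eval_zero]
    simp [bernoulliFunc, bernoulliFun, Polynomial.aeval_def, Polynomial.eval_map]
  rw [e] at h
  have h2 := resSum_int a m ha 0
  rw [Int.cast_zero] at h2
  rw [h2, eq_div_iff (by exact_mod_cast (pow_pos ha m).ne'), ← Complex.ofReal_ratCast, ← h,
    ← tsum_mul_right]
  congr 1
  funext l
  have ha' : (a : ℂ) ≠ 0 := by exact_mod_cast ha.ne'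
  simp only [Int.cast_zero, zero_add, Complex.ofReal_zero, mul_zero, Complex.exp_zero, mul_one,
    mul_pow]
  field_simp
lemma sum_range_zmod_s7 (a : ℕ) [NeZero a] (f : ZMod a → ℂ) :
    ∑ k ∈ Finset.range a, f (k : ZMod a) = ∑ u : ZMod a, f u := by
  refine Finset.sum_bij (fun k _ => (k : ZMod a)) (fun _ _ => Finset.mem_univ _) ?_ ?_
    (fun _ _ => rfl)
  · intro i hi j hj h
    rw [ZMod.natCast_eq_natCast_iff'] at h
    rwa [Nat.mod_eq_of_lt (Finset.mem_range.1 hi), Nat.mod_eq_of_lt (Finset.mem_range.1 hj)] at h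
  · intro u _
    exact ⟨u.val, Finset.mem_range.2 (ZMod.val_lt u), ZMod.natCast_zmod_val u⟩

lemma orth_aux (a : ℕ) [NeZero a] (b c : ZMod a) (hc : IsUnit c) (f g : ZMod a → ℂ) :
    ∑ j : ZMod a, (∑ r : ZMod a, ZMod.stdAddChar (j * b * r) * f r) *
      (∑ r : ZMod a, ZMod.stdAddChar (j * c * r) * g r) =
    a * ∑ u : ZMod a, f (c * u) * g (-(b * u)) := by
  have hbij : Function.Bijective (fun u : ZMod a => c * u) := by
    obtain ⟨v, rfl⟩ := hc
    exact (Units.mulLeft v).bijective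
  have h1 : ∀ j : ZMod a, (∑ r : ZMod a, ZMod.stdAddChar (j * b * r) * f r) =
      ∑ u : ZMod a, ZMod.stdAddChar (j * b * (c * u)) * f (c * u) := fun j =>
    (hbij.sum_comp (fun r => ZMod.stdAddChar (j * b * r) * f r)).symm
  simp_rw [h1, Finset.sum_mul_sum]
  rw [Finset.sum_comm, Finset.mul_sum]
  refine Finset.sum_congr rfl fun u _ => ?_
  rw [Finset.sum_comm]
  have h2 : ∀ r : ZMod a, ∑ j : ZMod a, ZMod.stdAddChar (j * b * (c * u)) * f (c * u) *
      (ZMod.stdAddChar (j * c * r) * g r) =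
      if r = -(b * u) then (a : ℂ) * (f (c * u) * g r) else 0 := by
    intro r
    have h3 := AddChar.sum_mulShift (c * (b * u + r)) (ZMod.isPrimitive_stdAddChar a)
    have h4 : c * (b * u + r) = 0 ↔ r = -(b * u) := by
      rw [hc.mul_right_eq_zero, add_comm, add_eq_zero_iff_eq_neg]
    have h5 : ∀ j : ZMod a, ZMod.stdAddChar (j * b * (c * u)) * f (c * u) *
      (ZMod.stdAddChar (j * c * r) * g r) =
        ZMod.stdAddChar (j * (c * (b * u + r))) * (f (c * u) * g r) := by
      intro j
      rw [show j * (c * (b * u + r)) = j * b * (c * u) + j * c * r by ring,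
        AddChar.map_add_eq_mul]
      ring
    simp_rw [h5]
    rw [← Finset.sum_mul, h3]
    simp only [h4, ZMod.card]
    split_ifs <;> simp
  simp_rw [h2]
  simp

lemma const_aux (a m : ℕ) (ha : 0 < a) (hm : 2 ≤ m) :
    (-1) ^ (m - 1) / ((m - 1).factorial : ℂ) * ((π : ℂ) / a) ^ m =
      bK m * (m * Complex.I ^ m / (2 ^ m * (a : ℂ) ^ m)) := by
  obtain ⟨k, rfl⟩ : ∃ k, m = k + 1 := ⟨m - 1, by lia⟩
  have ha' : (a : ℂ) ≠ 0 := by exact_mod_cast ha.ne'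
  have hf : (k.factorial : ℂ) ≠ 0 := by exact_mod_cast Nat.factorial_ne_zero _
  have hk : ((k : ℂ) + 1) ≠ 0 := by exact_mod_cast Nat.succ_ne_zero k
  have hI : Complex.I ^ (k + 1) * Complex.I ^ (k + 1) = -(-1) ^ k := by
    rw [← mul_pow, Complex.I_mul_I, pow_succ]; ring
  unfold bK
  rw [Nat.factorial_succ, Nat.add_sub_cancel, div_pow, mul_pow, mul_pow]
  push_cast
  rw [show -(2 ^ (k + 1) * (π : ℂ) ^ (k + 1) * Complex.I ^ (k + 1)) /
    (((k : ℂ) + 1) * (k.factorial : ℂ)) *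
    (((k : ℂ) + 1) * Complex.I ^ (k + 1) / (2 ^ (k + 1) * (a : ℂ) ^ (k + 1))) =
    -(2 ^ (k + 1) * (π : ℂ) ^ (k + 1) * (Complex.I ^ (k + 1) * Complex.I ^ (k + 1))) /
    (((k : ℂ) + 1) * (k.factorial : ℂ)) *
    (((k : ℂ) + 1) / (2 ^ (k + 1) * (a : ℂ) ^ (k + 1))) by ring, hI]
  field_simp

lemma sign_aux (m n : ℕ) (hpar : m % 2 = n % 2) :
    (-1 : ℂ) ^ (((m : ℤ) - n) / 2) = (-1) ^ n * (Complex.I ^ m * Complex.I ^ n) := by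
  have h2 : 2 * (((m : ℤ) - n) / 2) = (m : ℤ) - n := by lia
  have hI : Complex.I ^ n * Complex.I ^ n = (-1) ^ n := by
    rw [← mul_pow, Complex.I_mul_I]
  have hs : ((-1 : ℂ) ^ n) * (-1) ^ n = 1 := by
    rw [← mul_pow]; norm_num
  have hn0 : Complex.I ^ n ≠ 0 := pow_ne_zero _ Complex.I_ne_zero
  have : (-1 : ℂ) ^ (((m : ℤ) - n) / 2) = Complex.I ^ m / Complex.I ^ n := by
    rw [← zpow_natCast, ← zpow_natCast, ← zpow_sub₀ Complex.I_ne_zero, ← h2, zpow_mul]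
    norm_num
  rw [this, div_eq_iff hn0]
  linear_combination (-(-1) ^ n * Complex.I ^ m) * hI - Complex.I ^ m * hs

lemma bern_sign_aux (n : ℕ) (hn : 2 ≤ n) :
    (-1 : ℂ) ^ n * ((bernoulli n : ℚ) : ℂ) = ((bernoulli n : ℚ) : ℂ) := by
  rcases Nat.even_or_odd n with h | h
  · rw [h.neg_one_pow, one_mul]
  · rw [bernoulli_eq_zero_of_odd h (by lia)]; simp

/-- Cotangent representation of the Dedekind Bernoulli sum, for pairwise coprime `a, b, c`
and `m, n ≥ 2` of the same parity. -/
theorem dedekindBernoulliSum_eq_cot (a b c m n : ℕ) (ha : 0 < a) (hb : 0 < b) (hc : 0 < c)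
    (hab : Nat.Coprime a b) (hac : Nat.Coprime a c) (hbc : Nat.Coprime b c)
    (hm : 2 ≤ m) (hn : 2 ≤ n) (hpar : m % 2 = n % 2) :
    (dedekindBernoulliSum m n a b c : ℂ) =
      (m : ℂ) * n * (-1 : ℂ) ^ (((m : ℤ) - n) / 2) / 2 ^ (m + n) *
        ((1 : ℂ) / (a : ℂ) ^ (m + n - 1)) *
          ∑ k ∈ Finset.Icc 1 (a - 1),
            iteratedDeriv (m - 1) Complex.cot ((Real.pi : ℂ) * k * c / a) *
              iteratedDeriv (n - 1) Complex.cot ((Real.pi : ℂ) * k * b / a) +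
        ((bernoulli m : ℚ) : ℂ) * ((bernoulli n : ℚ) : ℂ) / (a : ℂ) ^ (m + n - 1) := by

  have : NeZero a := ⟨ha.ne'⟩
  have ha' : (a : ℂ) ≠ 0 := by exact_mod_cast ha.ne'
  have hcu : IsUnit (c : ZMod a) := (ZMod.isUnit_iff_coprime c a).2 hac.symm
  have hbu : IsUnit (b : ZMod a) := (ZMod.isUnit_iff_coprime b a).2 hab.symm
  have hKm := bK_ne m
  have hKn := bK_ne n
  have key : bK m * bK n * (dedekindBernoulliSum m n a b c : ℂ) =
      a * ∑ u : ZMod a, resSum a m (c * u) * resSum a n (-(b * u)) := by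
    rw [← orth_aux a b c hcu, ← sum_range_zmod_s7, dedekindBernoulliSum]
    push_cast
    rw [Finset.mul_sum]
    refine Finset.sum_congr rfl fun k _ => ?_
    have h1 := bernoulliFunc_zmod a m hm ((k : ℤ) * b)
    have h2 := bernoulliFunc_zmod a n hn ((k : ℤ) * c)
    push_cast at h1 h2
    rw [← h1, ← h2]
    ring
  have hsplit : ∑ u : ZMod a, resSum a m (c * u) * resSum a n (-(b * u)) =
      (-1) ^ n * (resSum a m 0 * resSum a n 0) +
      ∑ k ∈ Finset.Icc 1 (a - 1), (-1) ^ n *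
        (resSum a m ((k * c : ℤ) : ZMod a) * resSum a n ((k * b : ℤ) : ZMod a)) := by
    rw [← sum_range_zmod_s7]
    obtain ⟨d, rfl⟩ : ∃ d, a = d + 1 := ⟨a - 1, by lia⟩
    rw [Finset.range_eq_Ico, Finset.sum_eq_sum_Ico_succ_bot (by lia)]
    have : Finset.Ico (0 + 1) (d + 1) = Finset.Icc 1 (d + 1 - 1) := by
      ext; simp only [Finset.mem_Ico, Finset.mem_Icc]; lia
    rw [this]
    congr 1
    · rw [resSum_neg]; simp only [Nat.cast_zero, mul_zero]; ring
    · refine Finset.sum_congr rfl fun k _ => ?_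
      rw [resSum_neg]
      push_cast
      rw [mul_comm (c : ZMod (d + 1)), mul_comm (b : ZMod (d + 1))]
      ring
  have hterm : ∀ k ∈ Finset.Icc 1 (a - 1), (-1 : ℂ) ^ n *
        (resSum a m ((k * c : ℤ) : ZMod a) * resSum a n ((k * b : ℤ) : ZMod a)) =
      (bK m * bK n) * ((m : ℂ) * n * (-1 : ℂ) ^ (((m : ℤ) - n) / 2) / 2 ^ (m + n) *
        ((1 : ℂ) / (a : ℂ) ^ (m + n))) *
        (iteratedDeriv (m - 1) Complex.cot ((Real.pi : ℂ) * k * c / a) *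
              iteratedDeriv (n - 1) Complex.cot ((Real.pi : ℂ) * k * b / a)) := by
    intro k hk
    rw [Finset.mem_Icc] at hk
    have hk0 : (k : ZMod a) ≠ 0 := by
      rw [Ne, ZMod.natCast_eq_zero_iff]
      intro h
      have := Nat.le_of_dvd (by lia) h
      lia
    have hkc : (((k : ℤ) * c : ℤ) : ZMod a) ≠ 0 := by
      push_cast
      rwa [Ne, hcu.mul_left_eq_zero]
    have hkb : (((k : ℤ) * b : ℤ) : ZMod a) ≠ 0 := by
      push_cast
      rwa [Ne, hbu.mul_left_eq_zero]
    rw [resSum_cot a m ha hm _ hkc, resSum_cot a n ha hn _ hkb, const_aux a m ha hm,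
      const_aux a n ha hn, sign_aux m n hpar]
    push_cast
    rw [← mul_assoc (π : ℂ) (k : ℂ) (c : ℂ), ← mul_assoc (π : ℂ) (k : ℂ) (b : ℂ), pow_add, pow_add]
    field_simp
  rw [hsplit, Finset.sum_congr rfl hterm, ← Finset.mul_sum, resSum_zero a m ha hm,
    resSum_zero a n ha hn] at key
  have hb0 := bern_sign_aux n hn
  apply mul_left_cancel₀ (mul_ne_zero hKm hKn)
  rw [key]
  obtain ⟨d, hd⟩ : ∃ d, m + n = d + 1 := ⟨m + n - 1, by lia⟩
  have e1 : m + n - 1 = d := by lia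
  have e2 : (a : ℂ) ^ m * (a : ℂ) ^ n = (a : ℂ) ^ d * a := by
    rw [← pow_add, hd, pow_succ]
  have e3 : (-1 : ℂ) ^ n * (bK m * ((bernoulli m : ℚ) : ℂ) / (a : ℂ) ^ m *
      (bK n * ((bernoulli n : ℚ) : ℂ) / (a : ℂ) ^ n)) =
      bK m * bK n * (((bernoulli m : ℚ) : ℂ) * ((bernoulli n : ℚ) : ℂ)) / ((a : ℂ) ^ d * a) := by
    rw [← e2]
    field_simp
    linear_combination (((bernoulli m : ℚ) : ℂ)) * hb0
  rw [e3, e1, hd, pow_succ (a : ℂ) d, pow_succ (2 : ℂ) d]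
  generalize ∑ k ∈ Finset.Icc 1 (a - 1),
            iteratedDeriv (m - 1) Complex.cot ((Real.pi : ℂ) * k * c / a) *
              iteratedDeriv (n - 1) Complex.cot ((Real.pi : ℂ) * k * b / a) = T
  generalize (-1 : ℂ) ^ (((m : ℤ) - n) / 2) = ε
  field_simp
  ring
end

section
/- (Zagier's reciprocity law) If a_0,...,a_d are pairwise relatively prime positive integers and d is even, then Σ_{n=0}^{d} s(a_n; a_0,...,a_d omitting a_n) = 1 − h(a_0,...,a_d), where h(a_0,...,a_d) := (2^d/(a_0···a_d)) Σ_{k_0,...,k_d ≥ 0, k_0+···+k_d = d/2} (B_{2k_0}···B_{2k_d}/((2k_0)!···(2k_d)!)) a_0^{2k_0}···a_d^{2k_d}. -/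
open Real Finset
open scoped Classical

/-- Zagier's higher-dimensional Dedekind sum
`s(a₀; a_1,...,a_d) = ((−1)^{d/2}/a₀) Σ_{k=1}^{a₀−1} Π_j cot(πka_j/a₀)`,
for an index type `ι` of cardinality `d`. -/
noncomputable def higherDedekindSum (d : ℕ) (a₀ : ℕ) {ι : Type*} [Fintype ι] (a : ι → ℕ) : ℝ :=
  ((-1 : ℝ) ^ (d / 2) / a₀) *
    ∑ k ∈ Finset.Icc 1 (a₀ - 1), ∏ j, Real.cot (π * k * (a j) / a₀)


namespace ZR
open PowerSeries in
lemma b_ode : (X : ℂ⟦X⟧) * d⁄dX ℂ (bernoulliPowerSeries ℂ) =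
    bernoulliPowerSeries ℂ - X * bernoulliPowerSeries ℂ - bernoulliPowerSeries ℂ ^ 2 := by
  have h := bernoulliPowerSeries_mul_exp_sub_one ℂ
  have h2 := congrArg (d⁄dX ℂ) h
  rw [Derivation.leibniz, map_sub, derivative_exp, derivative_one, derivative_X] at h2
  simp only [smul_eq_mul, sub_zero] at h2
  set b := bernoulliPowerSeries ℂ
  linear_combination b * h2 - (d⁄dX ℂ b) * h - b * h

open PowerSeries in
lemma coeff_b_pow (m : ℕ) : coeff m (bernoulliPowerSeries ℂ ^ (m + 1)) = (-1) ^ m := by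
  induction m with
  | zero => simp [bernoulliPowerSeries]
  | succ m ih =>
    set b := bernoulliPowerSeries ℂ with hb
    have h : (X : ℂ⟦X⟧) * d⁄dX ℂ (b ^ (m + 1)) =
        ((m + 1 : ℕ) : ℂ⟦X⟧) * (b ^ (m + 1) - X * b ^ (m + 1) - b ^ (m + 2)) := by
      rw [derivative_pow]
      have := b_ode
      rw [← hb] at this
      simp only [Nat.add_sub_cancel]
      linear_combination ((m + 1 : ℕ) : ℂ⟦X⟧) * b ^ m * this
    have h2 := congrArg (coeff (m + 1)) h
    rw [coeff_succ_X_mul, coeff_derivative, ← nsmul_eq_mul, map_nsmul, map_sub, map_sub,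
      coeff_succ_X_mul, ih, nsmul_eq_mul] at h2
    have h3 : ((m : ℂ) + 1) ≠ 0 := by exact_mod_cast Nat.succ_ne_zero m
    apply mul_left_cancel₀ h3
    push_cast at h2
    linear_combination h2

open PowerSeries in
lemma b_pow_mul (d i : ℕ) (hi : i ≤ d) :
    (exp ℂ - 1) ^ i * bernoulliPowerSeries ℂ ^ (d + 1) =
      X ^ i * bernoulliPowerSeries ℂ ^ (d - i + 1) := by
  obtain ⟨j, rfl⟩ := Nat.exists_eq_add_of_le hi
  rw [← bernoulliPowerSeries_mul_exp_sub_one ℂ, Nat.add_sub_cancel_left, mul_pow]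
  ring

open PowerSeries in
lemma coeff_aeval_mul (d : ℕ) (p : Polynomial ℂ) (hp : p.natDegree ≤ d) :
    coeff d (Polynomial.aeval (exp ℂ) p * bernoulliPowerSeries ℂ ^ (d + 1)) =
      (-1) ^ d * p.eval 0 := by
  have h := Polynomial.sum_taylor_eq p 1
  rw [Polynomial.sum_over_range' _ (by simp) (d + 1) (by simpa using Nat.lt_succ_of_le hp)] at h
  generalize hc : (Polynomial.taylor 1 p).coeff = c at h
  rw [← h]
  rw [map_sum, Finset.sum_mul, map_sum, Polynomial.eval_finsetSum, Finset.mul_sum]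
  refine Finset.sum_congr rfl fun i hi => ?_
  have hi' : i ≤ d := by simpa [Nat.lt_succ_iff] using hi
  simp only [map_mul, map_pow, map_sub, Polynomial.aeval_X, Polynomial.aeval_C, map_one,
    Polynomial.eval_mul, Polynomial.eval_pow, Polynomial.eval_sub, Polynomial.eval_X,
    Polynomial.eval_C, Polynomial.eval_one]
  rw [mul_assoc, b_pow_mul d i hi', ← Algebra.smul_def, map_smul, coeff_X_pow_mul', if_pos hi',
    coeff_b_pow, smul_eq_mul]
  have : (-1 : ℂ) ^ d = (-1) ^ (d - i) * (-1) ^ i := by rw [← pow_add]; congr 1; omega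
  rw [this, zero_sub]
  have h1 : ((-1 : ℂ) ^ i) * (-1) ^ i = 1 := by rw [← mul_pow]; simp
  linear_combination - c i * (-1) ^ (d - i) * h1

open PowerSeries in
lemma b_rescale (a : ℕ) :
    rescale (a : ℂ) (bernoulliPowerSeries ℂ) * (exp ℂ ^ a - 1) = (a : ℂ⟦X⟧) * X := by
  have := congrArg (rescale (a : ℂ)) (bernoulliPowerSeries_mul_exp_sub_one ℂ)
  rw [map_mul, map_sub, map_one, ← exp_pow_eq_rescale_exp, rescale_X] at this
  simpa using this

open PowerSeries in
lemma b_even (a : ℕ) (m : ℕ) :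
    coeff m (rescale (a : ℂ) (bernoulliPowerSeries ℂ) * (exp ℂ ^ a + 1)) =
      if Even m then 2 * (((bernoulli m : ℚ) : ℂ) / (Nat.factorial m : ℂ) * (a : ℂ) ^ m) else 0 := by
  have : rescale (a : ℂ) (bernoulliPowerSeries ℂ) * (exp ℂ ^ a + 1) =
     rescale (a : ℂ) (2 * bernoulliPowerSeries ℂ + X) := by
    rw [map_add, map_mul, rescale_X]
    have := b_rescale a
    simp only [map_ofNat, map_natCast]
    linear_combination this
  rw [this, coeff_rescale, map_add, coeff_X, two_mul, map_add, bernoulliPowerSeries, coeff_mk]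
  split_ifs with h1 h2 h2
  · subst h1; exact absurd h2 (by decide)
  · subst h1; simp
  · simp; ring
  · have := bernoulli_eq_zero_of_odd (n := m) (by simpa using h2) (by
      rcases m with _ | _ | m
      · simp at h2
      · simp at h1
      · omega)
    simp [this]

open PowerSeries in
lemma coeff_main (d : ℕ) (hd : Even d) (a : Fin (d + 1) → ℕ) :
    coeff d (∏ i, (rescale (a i : ℂ) (bernoulliPowerSeries ℂ) * (exp ℂ ^ (a i) + 1))) =
      2 ^ (d + 1) * ∑ k ∈ (Fintype.piFinset fun _ : Fin (d + 1) => Finset.range (d / 2 + 1)).filter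
            (fun k => ∑ i, k i = d / 2),
          ∏ i, ((bernoulli (2 * k i) : ℚ) : ℂ) / (Nat.factorial (2 * k i) : ℂ) *
            (a i : ℂ) ^ (2 * k i) := by
  rw [coeff_prod, Finset.mul_sum]
  symm
  obtain ⟨e, rfl⟩ := hd
  refine Finset.sum_of_injOn (fun k => Finsupp.equivFunOnFinite.symm (fun i => 2 * k i)) ?_ ?_ ?_ ?_
  · intro k _ l _ h
    have h' := Finsupp.equivFunOnFinite.symm.injective h
    funext i
    have := congrFun h' i
    omega
  · intro k hk
    simp only [Finset.coe_filter, Set.mem_ofPred_eq] at hk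
    simp only [Finset.mem_coe, mem_finsuppAntidiag, Finset.subset_univ, and_true]
    have : ∑ i, 2 * k i = e + e := by rw [← Finset.mul_sum, hk.2]; omega
    simpa using this
  · intro l hl hn
    simp only [mem_finsuppAntidiag, Finset.subset_univ, and_true] at hl
    by_cases hall : ∀ i, Even (l i)
    · exfalso
      apply hn
      refine ⟨fun i => l i / 2, ?_, ?_⟩
      · simp only [Finset.coe_filter, Set.mem_ofPred_eq, Fintype.mem_piFinset, Finset.mem_range]
        have hs : 2 * ∑ i, l i / 2 = e + e := by
          refine Eq.trans ?_ hl
          rw [Finset.mul_sum]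
          exact Finset.sum_congr rfl fun i _ => Nat.two_mul_div_two_of_even (hall i)
        refine ⟨fun i => ?_, by omega⟩
        have := Finset.single_le_sum (f := fun i => l i / 2) (fun _ _ => Nat.zero_le _)
          (Finset.mem_univ i)
        omega
      · ext i
        simpa using Nat.two_mul_div_two_of_even (hall i)
    · push Not at hall
      obtain ⟨i, hi⟩ := hall
      apply Finset.prod_eq_zero (Finset.mem_univ i)
      rw [b_even, if_neg (by simpa using hi)]
  · intro k hk
    have : (2 : ℂ) ^ (e + e + 1) = ∏ i : Fin (e + e + 1), 2 := by simp
    rw [this, ← Finset.prod_mul_distrib]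
    refine Finset.prod_congr rfl fun i _ => ?_
    rw [b_even]
    simp

open Polynomial in
lemma pf (d : ℕ) (M N : ℂ[X]) (hM : M.Monic) (hN : N.Monic) (hM1 : M.eval 1 ≠ 0)
    (hdeg : N.natDegree = d + 1 + M.natDegree) :
    ∃ p q : ℂ[X], N = (X - 1) ^ (d + 1) * M + p * M + q * (X - 1) ^ (d + 1) ∧ p.natDegree ≤ d ∧
      q.degree < M.degree := by
  have hE1 : (X - 1 : ℂ[X]).Monic := by simpa using monic_X_sub_C (1 : ℂ)
  have hE : ((X - 1 : ℂ[X]) ^ (d + 1)).Monic := hE1.pow _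
  have hEd : ((X - 1 : ℂ[X]) ^ (d + 1)).natDegree = d + 1 := by
    rw [hE1.natDegree_pow]
    have : (X - 1 : ℂ[X]).natDegree = 1 := by simpa using natDegree_X_sub_C (1 : ℂ)
    rw [this, mul_one]
  have hcop : IsCoprime ((X - 1 : ℂ[X]) ^ (d + 1)) M := by
    apply IsCoprime.pow_left
    have hirr : Irreducible (X - 1 : ℂ[X]) := by simpa using irreducible_X_sub_C (1 : ℂ)
    refine (hirr.coprime_iff_not_dvd).2 fun h => hM1 ?_
    have : (X - C 1 : ℂ[X]) ∣ M := by simpa using h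
    exact dvd_iff_isRoot.1 this
  obtain ⟨u, v, huv⟩ := hcop
  set E := (X - 1 : ℂ[X]) ^ (d + 1) with hEdef
  set R := N - E * M with hR
  set p := (v * R) %ₘ E with hp
  have hpE : p + E * ((v * R) /ₘ E) = v * R := modByMonic_add_div _ _
  have hpd : p.degree < E.degree := degree_modByMonic_lt _ hE
  set q := u * R + ((v * R) /ₘ E) * M with hq
  have hRe : R = p * M + q * E := by
    rw [hq]
    linear_combination (-R) * huv - M * hpE
  refine ⟨p, q, ?_, ?_, ?_⟩
  · linear_combination hRe
  · have : p.natDegree < E.natDegree := by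
      have h0 : E ≠ 0 := hE.ne_zero
      by_cases hp0 : p = 0
      · rw [hp0, natDegree_zero]; omega
      · exact natDegree_lt_natDegree hp0 hpd
    omega
  · have h1 : R.degree < N.degree := by
      apply degree_sub_lt_left _ hN.ne_zero
      · rw [hN.leadingCoeff, (hE.mul hM).leadingCoeff]
      · rw [degree_eq_natDegree hN.ne_zero, degree_eq_natDegree (hE.mul hM).ne_zero,
          hE.natDegree_mul hM, hdeg, hEd]
    have hNd : N.degree = E.degree + M.degree := by
      rw [degree_eq_natDegree hN.ne_zero, degree_eq_natDegree hE.ne_zero,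
        degree_eq_natDegree hM.ne_zero, hdeg, hEd]
      push_cast; rfl
    have h2 : (p * M).degree < N.degree := by
      rw [degree_mul, hNd]
      exact WithBot.add_lt_add_right (degree_ne_bot.2 hM.ne_zero) hpd
    have h3 : (q * E).degree < N.degree := by
      rw [show q * E = R - p * M by rw [hRe]; ring]
      exact lt_of_le_of_lt (degree_sub_le _ _) (max_lt h1 h2)
    rw [degree_mul, hNd, add_comm] at h3
    exact lt_of_add_lt_add_left h3

open Polynomial in
lemma prod_roots (n : ℕ) (hn : 0 < n) (ζ : ℂ) (hζ : IsPrimitiveRoot ζ n) :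
    (X - 1 : ℂ[X]) * ∏ k ∈ Finset.Icc 1 (n - 1), (X - C (ζ ^ k)) = X ^ n - 1 := by
  have h := X_pow_sub_C_eq_prod hζ hn (one_pow n)
  obtain ⟨m, rfl⟩ : ∃ m, n = m + 1 := ⟨n - 1, by omega⟩
  rw [Finset.prod_range_succ'] at h
  simp only [map_one, mul_one, pow_zero] at h
  rw [h, mul_comm]
  congr 1
  rw [Nat.add_sub_cancel, Finset.range_eq_Ico, Finset.prod_Ico_add' (fun k => X - C (ζ ^ k)) 0 m 1]
  congr 1

noncomputable def z (n : ℕ) : ℂ := Complex.exp (2 * π * Complex.I / n)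

noncomputable def v {d : ℕ} (a : Fin (d + 1) → ℕ) (x : Σ _ : Fin (d + 1), ℕ) : ℂ := z (a x.1) ^ x.2

def S {d : ℕ} (a : Fin (d + 1) → ℕ) : Finset (Σ _ : Fin (d + 1), ℕ) :=
  Finset.univ.sigma fun n => Finset.Icc 1 (a n - 1)

lemma z_prim (n : ℕ) (hn : 0 < n) : IsPrimitiveRoot (z n) n := Complex.isPrimitiveRoot_exp n hn.ne'


lemma v_pow {d : ℕ} (a : Fin (d + 1) → ℕ) (ha : ∀ i, 0 < a i)
    (x) : v a x ^ a x.1 = 1 := by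
  rw [v, ← pow_mul, mul_comm, pow_mul, (z_prim _ (ha _)).pow_eq_one, one_pow]

lemma v_ne_one {d : ℕ} (a : Fin (d + 1) → ℕ) (ha : ∀ i, 0 < a i)
    (x) (hx : x ∈ S a) : v a x ≠ 1 := by
  simp only [S, Finset.mem_sigma, Finset.mem_Icc] at hx
  have h := hx.2
  exact (z_prim _ (ha _)).pow_ne_one_of_pos_of_lt (by omega) (by omega)

lemma v_ne_zero {d : ℕ} (a : Fin (d + 1) → ℕ) (ha : ∀ i, 0 < a i)
    (x) : v a x ≠ 0 := by
  intro h
  have := v_pow a ha x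
  rw [h, zero_pow (ha _).ne'] at this
  exact zero_ne_one this

lemma v_pow_ne {d : ℕ} (a : Fin (d + 1) → ℕ) (ha : ∀ i, 0 < a i)
    (hcop : ∀ i j, i ≠ j → Nat.Coprime (a i) (a j))
    (x) (hx : x ∈ S a) (j) (hj : j ≠ x.1) : v a x ^ a j ≠ 1 := by
  intro h
  have := pow_gcd_eq_one.2 ⟨h, v_pow a ha x⟩
  rw [hcop j x.1 hj, pow_one] at this
  exact v_ne_one a ha x hx this

lemma v_inj {d : ℕ} (a : Fin (d + 1) → ℕ) (ha : ∀ i, 0 < a i)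
    (hcop : ∀ i j, i ≠ j → Nat.Coprime (a i) (a j))
    : Set.InjOn (v a) (S a) := by
  intro x hx y hy h
  by_cases hxy : x.1 = y.1
  · obtain ⟨n, k⟩ := x
    obtain ⟨m, l⟩ := y
    simp only at hxy
    subst hxy
    simp only [S, Finset.mem_coe, Finset.mem_sigma, Finset.mem_Icc] at hx hy
    have := (z_prim _ (ha n)).pow_inj (i := k) (j := l) (by omega) (by omega) h
    rw [this]
  · exfalso
    refine v_pow_ne a ha hcop x hx y.1 (Ne.symm hxy) ?_
    rw [h, v_pow a ha]

open Polynomial in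
lemma nodal_mul {d : ℕ} (a : Fin (d + 1) → ℕ) (ha : ∀ i, 0 < a i)
    : (X - 1 : ℂ[X]) ^ (d + 1) * Lagrange.nodal (S a) (v a) = ∏ i, (X ^ a i - 1) := by
  rw [Lagrange.nodal_eq, S, Finset.prod_sigma]
  have : (X - 1 : ℂ[X]) ^ (d + 1) = ∏ i : Fin (d + 1), (X - 1) := by simp
  rw [this, ← Finset.prod_mul_distrib]
  simp only [v]
  exact Finset.prod_congr rfl fun i _ => prod_roots _ (ha i) _ (z_prim _ (ha i))

lemma cot_ratio (w : ℂ) (h : Complex.exp (2 * Complex.I * w) ≠ 1) :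
    (Complex.exp (2 * Complex.I * w) + 1) / (Complex.exp (2 * Complex.I * w) - 1) =
      -Complex.I * Complex.cot w := by
  rw [Complex.cot_eq_exp_ratio]
  set E := Complex.exp (2 * Complex.I * w)
  have h1 : E - 1 ≠ 0 := sub_ne_zero.2 h
  have h2 : 1 - E ≠ 0 := sub_ne_zero.2 (Ne.symm h)
  have h3 := Complex.I_ne_zero
  field_simp
  ring


lemma ratio_eq {d : ℕ} (a : Fin (d + 1) → ℕ) (ha : ∀ i, 0 < a i)
    (hcop : ∀ i j, i ≠ j → Nat.Coprime (a i) (a j))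
    (x) (hx : x ∈ S a) (j) (hj : j ≠ x.1) :
    (v a x ^ a j + 1) / (v a x ^ a j - 1) =
      -Complex.I * ((Real.cot (π * x.2 * (a j) / a x.1) : ℝ) : ℂ) := by
  have h0 := v_pow_ne a ha hcop x hx j hj
  have : v a x ^ a j =
      Complex.exp (2 * Complex.I * ((π * x.2 * (a j) / a x.1 : ℝ) : ℂ)) := by
    rw [v, z, ← pow_mul, ← Complex.exp_nat_mul]
    congr 1
    push_cast
    ring
  rw [this] at h0 ⊢
  rw [cot_ratio _ h0, Complex.ofReal_cot]

open Polynomial in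
lemma residue {d : ℕ} (a : Fin (d + 1) → ℕ) (ha : ∀ i, 0 < a i)
    (hcop : ∀ i j, i ≠ j → Nat.Coprime (a i) (a j))
    (hd : Even d) (q p : ℂ[X])
    (h : ∏ i, (X ^ a i + 1) = (X - 1) ^ (d + 1) * Lagrange.nodal (S a) (v a) +
      p * Lagrange.nodal (S a) (v a) + q * (X - 1) ^ (d + 1)) (x) (hx : x ∈ S a) :
    Lagrange.nodalWeight (S a) (v a) x * (0 - v a x)⁻¹ * q.eval (v a x) =
      - (2 * ((-1) ^ (d / 2) / (a x.1 : ℂ) * ∏ j : {j : Fin (d + 1) // j ≠ x.1},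
        ((Real.cot (π * x.2 * (a j.1) / a x.1) : ℝ) : ℂ))) := by
  have hprod : ∏ j : {j : Fin (d + 1) // j ≠ x.1}, 
      ((v a x ^ a j.1 + 1) / (v a x ^ a j.1 - 1)) = (-1) ^ (d / 2) * 
      ∏ j : {j : Fin (d + 1) // j ≠ x.1},
        ((Real.cot (π * x.2 * (a j.1) / a x.1) : ℝ) : ℂ) := by
    rw [Finset.prod_congr rfl fun j _ => ratio_eq a ha hcop x hx j.1 j.2, Finset.prod_mul_distrib,
      Finset.prod_const]
    congr 1
    have : (Finset.univ : Finset {j : Fin (d + 1) // j ≠ x.1}).card = d := by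
      simp [Fintype.card_subtype_compl]
    rw [this]
    obtain ⟨e, rfl⟩ := hd
    rw [show (e + e) / 2 = e by omega, ← two_mul, pow_mul]
    simp
  have hM := Lagrange.eval_nodal_at_node (v := v a) hx
  rw [Lagrange.nodalWeight_eq_eval_derivative_nodal hx]
  have hder := congrArg (fun f => eval (v a x) (derivative f)) (nodal_mul a ha)
  simp only [derivative_mul, eval_add, eval_mul, hM, mul_zero, zero_add] at hder
  have hsplit : ∀ f : Fin (d + 1) → ℂ[X], ∏ i, f i =
      f x.1 * ∏ j : {j : Fin (d + 1) // j ≠ x.1}, f j.1 := fun f => Fintype.prod_eq_mul_prod_subtype_ne f x.1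
  rw [hsplit] at hder
  have hev := congrArg (eval (v a x)) h
  rw [hsplit] at hev
  have hvp := v_pow a ha x
  have hv0 := v_ne_zero a ha x
  have hv1 := sub_ne_zero.2 (v_ne_one a ha x hx)
  simp only [derivative_mul, eval_add, eval_mul, eval_sub, eval_pow, eval_X, eval_one, hvp,
    sub_self, zero_mul, add_zero, derivative_sub, derivative_X_pow, derivative_one, eval_prod, hM,
    mul_zero, zero_add, sub_zero, eval_natCast, map_natCast] at hder hev
  have hP : ∏ j : {j : Fin (d + 1) // j ≠ x.1}, (v a x ^ a j.1 - 1) ≠ 0 :=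
    Finset.prod_ne_zero_iff.2 fun j _ => sub_ne_zero.2 (v_pow_ne a ha hcop x hx j.1 j.2)
  rw [Finset.prod_div_distrib] at hprod
  set P := ∏ j : {j : Fin (d + 1) // j ≠ x.1}, (v a x ^ a j.1 - 1)
  set Q := ∏ j : {j : Fin (d + 1) // j ≠ x.1}, (v a x ^ a j.1 + 1)
  rw [div_mul_eq_mul_div, ← hprod]
  have ha0 : (a x.1 : ℂ) ≠ 0 := by exact_mod_cast (ha _).ne'
  have hvv : v a x ^ (a x.1 - 1) * v a x = 1 := by
    rw [← pow_succ, Nat.sub_add_cancel (ha _), hvp]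
  set M' := eval (v a x) (derivative (Lagrange.nodal (S a) (v a)))
  have hM' : (v a x - 1) ^ (d + 1) * (M' * v a x) = a x.1 * P := by
    linear_combination v a x * hder + a x.1 * P * hvv
  have hM0 : M' ≠ 0 := by
    rintro h0
    rw [h0, zero_mul, mul_zero] at hM'
    exact mul_ne_zero ha0 hP hM'.symm
  have hE0 : (v a x - 1) ^ (d + 1) ≠ 0 := pow_ne_zero _ hv1
  rw [zero_sub]
  field_simp
  apply mul_right_cancel₀ hE0
  linear_combination 2 * Q * hM' + (a x.1) * P * hev

open PowerSeries in
lemma series_id {d : ℕ} (hd : Even d) (a : Fin (d + 1) → ℕ) (M p q : Polynomial ℂ)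
    (hp : p.natDegree ≤ d)
    (hM : (Polynomial.X - 1) ^ (d + 1) * M = ∏ i, (Polynomial.X ^ a i - 1))
    (h : ∏ i, (Polynomial.X ^ a i + 1) = (Polynomial.X - 1) ^ (d + 1) * M + p * M +
      q * (Polynomial.X - 1) ^ (d + 1)) :
    coeff d (∏ i, (rescale (a i : ℂ) (bernoulliPowerSeries ℂ) * (exp ℂ ^ (a i) + 1))) =
      (∏ i, (a i : ℂ)) * p.eval 0 := by
  have hb := bernoulliPowerSeries_mul_exp_sub_one ℂ
  have hbr := fun i => b_rescale (a i)
  have hM' := congrArg (Polynomial.aeval (exp ℂ)) hM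
  have h' := congrArg (Polynomial.aeval (exp ℂ)) h
  have hc := coeff_aeval_mul d p hp
  simp only [map_mul, map_add, map_sub, map_pow, map_one, map_prod, Polynomial.aeval_X] at hM' h'
  rw [Finset.prod_mul_distrib, h']
  have hB : (∏ i, rescale (a i : ℂ) (bernoulliPowerSeries ℂ)) * ∏ i, (exp ℂ ^ a i - 1) =
      (∏ i, (a i : ℂ⟦X⟧)) * X ^ (d + 1) := by
    rw [← Finset.prod_mul_distrib, Finset.prod_congr rfl fun i _ => hbr i,
      Finset.prod_mul_distrib]
    simp
  rw [← hM'] at hB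
  set B := ∏ i, rescale (a i : ℂ) (bernoulliPowerSeries ℂ)
  set b := bernoulliPowerSeries ℂ
  set E := exp ℂ - 1
  have hE0 : E ^ (d + 1) ≠ 0 := by
    apply pow_ne_zero
    intro h0
    rw [h0, mul_zero] at hb
    exact X_ne_zero hb.symm
  have hMB : B * Polynomial.aeval (exp ℂ) M = (∏ i, (a i : ℂ⟦X⟧)) * b ^ (d + 1) := by
    apply mul_right_cancel₀ hE0
    rw [mul_assoc (∏ i, (a i : ℂ⟦X⟧)), ← mul_pow, hb, ← hB]
    ring
  have hXE : (X : ℂ⟦X⟧) ∣ E := by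
    rw [X_dvd_iff]
    simp [E]
  obtain ⟨w, hw⟩ := hXE
  have hA : (∏ i, (a i : ℂ⟦X⟧)) = C (∏ i, (a i : ℂ)) := by
    rw [map_prod]; simp
  have hfin : B * (E ^ (d + 1) * Polynomial.aeval (exp ℂ) M +
      Polynomial.aeval (exp ℂ) p * Polynomial.aeval (exp ℂ) M +
      Polynomial.aeval (exp ℂ) q * E ^ (d + 1)) =
      C (∏ i, (a i : ℂ)) * (Polynomial.aeval (exp ℂ) p * b ^ (d + 1)) +
      X ^ (d + 1) * (C (∏ i, (a i : ℂ)) + B * Polynomial.aeval (exp ℂ) q * w ^ (d + 1)) := by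
    have : E ^ (d + 1) = X ^ (d + 1) * w ^ (d + 1) := by rw [hw, mul_pow]
    rw [← hA]
    linear_combination hB + Polynomial.aeval (exp ℂ) p * hMB + B * Polynomial.aeval (exp ℂ) q * this
  rw [hfin, map_add, coeff_C_mul, hc, coeff_X_pow_mul', if_neg (by omega), hd.neg_one_pow]
  ring

open Polynomial in
lemma monic_plus (n : ℕ) (hn : 0 < n) : (X ^ n + 1 : ℂ[X]).Monic := by
  simpa using monic_X_pow_add_C (1 : ℂ) hn.ne'

open Polynomial in
lemma main_complex {d : ℕ} (hd : Even d) (a : Fin (d + 1) → ℕ) (ha : ∀ i, 0 < a i)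
    (hcop : ∀ i j, i ≠ j → Nat.Coprime (a i) (a j)) :
    (∑ x ∈ S a, ((-1) ^ (d / 2) / (a x.1 : ℂ) * ∏ j : {j : Fin (d + 1) // j ≠ x.1},
        ((Real.cot (π * x.2 * (a j.1) / a x.1) : ℝ) : ℂ))) =
      1 - (2 : ℂ) ^ d / (∏ i, (a i : ℂ)) *
        ∑ k ∈ (Fintype.piFinset fun _ : Fin (d + 1) => Finset.range (d / 2 + 1)).filter
            (fun k => ∑ i, k i = d / 2),
          ∏ i, ((bernoulli (2 * k i) : ℚ) : ℂ) / (Nat.factorial (2 * k i) : ℂ) *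
            (a i : ℂ) ^ (2 * k i) := by
  have hnod := nodal_mul a ha
  have hodd : Odd (d + 1) := hd.add_one
  have hM1 : (Lagrange.nodal (S a) (v a)).eval 1 ≠ 0 :=
    Lagrange.eval_nodal_not_at_node fun x hx => (v_ne_one a ha x hx).symm
  have hMm : (Lagrange.nodal (S a) (v a)).Monic := Lagrange.nodal_monic
  have hMd : (Lagrange.nodal (S a) (v a)).degree = #(S a) := Lagrange.degree_nodal
  have hq := fun q : ℂ[X] => fun h : q.degree < #(S a) =>
    congrArg (eval 0) (Lagrange.eq_interpolate (v_inj a ha hcop) h)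
  have hres := residue a ha hcop hd
  have hint := fun r => Lagrange.eval_interpolate_not_at_node (s := S a) (v := v a) (x := 0) r
    (fun x _ => (v_ne_zero a ha x).symm)
  have hdeg : (∏ i, (X ^ a i + 1 : ℂ[X])).natDegree =
      d + 1 + (Lagrange.nodal (S a) (v a)).natDegree := by
    have hE1 : (X - 1 : ℂ[X]).Monic := by simpa using monic_X_sub_C (1 : ℂ)
    have h1 := congrArg natDegree hnod
    rw [(hE1.pow _).natDegree_mul hMm, hE1.natDegree_pow,
      natDegree_prod_of_monic _ _ fun i _ => by simpa using monic_X_pow_sub_C (1 : ℂ) (ha i).ne'] at h1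
    have h2 : (X - 1 : ℂ[X]).natDegree = 1 := by simpa using natDegree_X_sub_C (1 : ℂ)
    have h3 : ∀ n, (X ^ n - 1 : ℂ[X]).natDegree = n := fun n => by
      simpa using natDegree_X_pow_sub_C (n := n) (r := (1 : ℂ))
    have h4 : ∀ n, (X ^ n + 1 : ℂ[X]).natDegree = n := fun n => by
      simpa using natDegree_X_pow_add_C (n := n) (r := (1 : ℂ))
    rw [natDegree_prod_of_monic _ _ fun i _ => monic_plus _ (ha i)]
    simp only [h2, h3, h4, mul_one] at h1 ⊢
    exact h1.symm
  obtain ⟨p, q, hpq, hpd, hqd⟩ := pf d (Lagrange.nodal (S a) (v a)) (∏ i, (X ^ a i + 1)) hMm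
    (monic_prod_of_monic _ _ fun i _ => monic_plus _ (ha i)) hM1 hdeg
  have hser := series_id hd a _ p q hpd hnod hpq
  rw [coeff_main d hd] at hser
  have h0 := congrArg (eval 0) hnod
  have h00 := congrArg (eval 0) hpq
  simp only [eval_mul, eval_pow, eval_sub, eval_X, eval_one, eval_prod, eval_add, zero_sub,
    zero_pow (ha _).ne', Finset.prod_const, Finset.card_univ, Fintype.card_fin, hodd.neg_one_pow,
    zero_add, one_pow] at h0 h00
  have hN0 : eval 0 (Lagrange.nodal (S a) (v a)) = 1 := by linear_combination -h0
  have hq0 := hq q (hMd ▸ hqd)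
  rw [hint, hN0, one_mul, Finset.sum_congr rfl fun x hx => hres q p hpq x hx,
    Finset.sum_neg_distrib, ← Finset.mul_sum] at hq0
  rw [hN0] at h00
  have hA : (∏ i, (a i : ℂ)) ≠ 0 :=
    Finset.prod_ne_zero_iff.2 fun i _ => by exact_mod_cast (ha i).ne'
  rw [div_mul_eq_mul_div]
  have hp0 : p.eval 0 = 2 * (2 ^ d * (∑ k ∈ (Fintype.piFinset fun _ : Fin (d + 1) =>
      Finset.range (d / 2 + 1)).filter (fun k => ∑ i, k i = d / 2),
          ∏ i, ((bernoulli (2 * k i) : ℚ) : ℂ) / (Nat.factorial (2 * k i) : ℂ) *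
            (a i : ℂ) ^ (2 * k i)) / ∏ i, (a i : ℂ)) := by
    rw [← mul_div_assoc, eq_div_iff hA]
    linear_combination -hser
  linear_combination (1/2) * hq0 - (1/2) * h00 - (1/2) * hp0
end ZR

/-- Zagier's reciprocity law for higher-dimensional Dedekind sums. -/
theorem zagier_reciprocity (d : ℕ) (hd : Even d) (a : Fin (d + 1) → ℕ) (ha : ∀ i, 0 < a i)
    (hcop : ∀ i j, i ≠ j → Nat.Coprime (a i) (a j)) :
    (∑ n : Fin (d + 1),
        higherDedekindSum d (a n) (fun j : {j : Fin (d + 1) // j ≠ n} => a j.1)) =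
      1 - (2 : ℝ) ^ d / (∏ i, (a i : ℝ)) *
        ∑ k ∈ (Fintype.piFinset fun _ : Fin (d + 1) => Finset.range (d / 2 + 1)).filter
            (fun k => ∑ i, k i = d / 2),
          ∏ i, ((bernoulli (2 * k i) : ℚ) : ℝ) / (Nat.factorial (2 * k i) : ℝ) *
            (a i : ℝ) ^ (2 * k i) := by
  apply Complex.ofReal_injective
  have h := ZR.main_complex hd a ha hcop
  rw [ZR.S, Finset.sum_sigma] at h
  simp only [higherDedekindSum, Finset.mul_sum]
  simp only [Finset.mul_sum] at h
  push_cast at h ⊢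
  exact h
end

section
/- (Generalized Petersson–Knopp identity) Let n, a, a_1,...,a_d be positive integers and suppose S(a; a_1,...,a_d) = Σ_{k mod a} f_1(k a_1/a)···f_d(k a_d/a) is of Dedekind type with weight (m_1,...,m_d). Then Σ_{b|n} b^{−m_1−···−m_d} Σ_{r_1,...,r_d mod b} S(ab; (n/b)a_1 + r_1 a, ..., (n/b)a_d + r_d a) = n · σ_{d−1−m_1−···−m_d}(n) · S(a; a_1,...,a_d), where σ_m(n) = Σ_{d|n} d^m. -/
open Real Finset

/-- The sum `S(a; a_1,...,a_d) = Σ_{k mod a} f_1(k a_1/a) ··· f_d(k a_d/a)`. -/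
noncomputable def dedekindTypeSum {d : ℕ} (f : Fin d → ℝ → ℂ) (a : ℕ) (A : Fin d → ℕ) : ℂ :=
  ∑ k ∈ Finset.range a, ∏ j, f j ((k : ℝ) * A j / a)

lemma pk_sum_periodic (h : ℕ → ℂ) (b : ℕ) (hp : ∀ r, h (r + b) = h r) (g : ℕ) :
    ∑ r ∈ range (g * b), h r = g * ∑ r ∈ range b, h r := by
  have hq : ∀ q r, h (q * b + r) = h r := by
    intro q
    induction q with
    | zero => intro r; simp
    | succ q ih =>
      intro r
      have : (q + 1) * b + r = (q * b + r) + b := by ring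
      rw [this, hp, ih]
  induction g with
  | zero => simp
  | succ g ih =>
    rw [Nat.succ_mul, sum_range_add, ih]
    simp only [hq]
    push_cast
    ring

lemma pk_sum_coprime (h : ℕ → ℂ) (b : ℕ) (hb : 0 < b) (hp : ∀ r, h (r + b) = h r)
    (k : ℕ) (hk : Nat.Coprime k b) :
    ∑ r ∈ range b, h (k * r) = ∑ r ∈ range b, h r := by
  have hm : ∀ r, h (r % b) = h r := fun r => (show Function.Periodic h b from hp).map_mod_nat r
  have hmaps : ∀ r ∈ range b, (k * r) % b ∈ range b := fun r _ => mem_range.2 (Nat.mod_lt _ hb)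
  have hinj : Set.InjOn (fun r => (k * r) % b) (range b : Set ℕ) := by
    intro r hr s hs hrs
    simp only [coe_range, Set.mem_Iio] at hr hs
    have h1 : k * r ≡ k * s [MOD b] := hrs
    have h2 : r ≡ s [MOD b] := Nat.ModEq.cancel_left_of_coprime (by rw [Nat.gcd_comm]; exact hk) h1
    exact Nat.ModEq.eq_of_lt_of_lt h2 hr hs
  refine sum_nbij (fun r => (k * r) % b) hmaps hinj ?_ (fun r _ => (hm _).symm)
  exact Finset.surjOn_of_injOn_of_card_le _ hmaps hinj le_rfl

lemma pk_inner (f : ℝ → ℂ) (m : ℤ) (hper : ∀ x, f (x + 1) = f x)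
    (hw : ∀ (a : ℕ), 0 < a → ∀ x : ℝ,
      ∑ k ∈ Finset.range a, f (x + k / a) = (a : ℂ) ^ m * f (a * x))
    (g k b : ℕ) (hg : 0 < g) (hb : 0 < b) (hk : Nat.Coprime k b) (x : ℝ) :
    ∑ r ∈ range (g * b), f (x + (g * k : ℕ) * r / (g * b : ℕ)) =
      g * ((b : ℂ) ^ m * f (b * x)) := by
  have hb' : (b : ℝ) ≠ 0 := by positivity
  have hg' : (g : ℝ) ≠ 0 := by positivity
  have hp : ∀ r : ℕ, f (x + ((r + b : ℕ) : ℝ) / b) = f (x + (r : ℝ) / b) := by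
    intro r
    rw [← hper (x + r / b)]
    congr 1
    push_cast
    field_simp
    try ring
  have hpk : ∀ r : ℕ, f (x + ((k * (r + b) : ℕ) : ℝ) / b) = f (x + ((k * r : ℕ) : ℝ) / b) := by
    intro r
    have := (show Function.Periodic f 1 from hper).nat_mul k (x + ((k * r : ℕ) : ℝ) / b)
    rw [← this]
    congr 1
    push_cast
    field_simp
    try ring
  rw [← hw b hb, ← pk_sum_coprime (fun r => f (x + (r : ℝ) / b)) b hb hp k hk,
    ← pk_sum_periodic (fun r => f (x + ((k * r : ℕ) : ℝ) / b)) b hpk g]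
  refine sum_congr rfl fun r _ => ?_
  congr 2
  push_cast
  field_simp

lemma pk_biject (G : ℕ → ℕ → ℂ) (n a : ℕ) (hn : 0 < n) :
    ∑ b ∈ n.divisors, ∑ k ∈ range (a * b), G (Nat.gcd k b) (k / Nat.gcd k b * (n / b)) =
    ∑ g ∈ n.divisors, ∑ t ∈ range (a * (n / g)), G g t := by
  rw [sum_sigma', sum_sigma']
  have key1 : ∀ b k, b ∣ n → ∃ g b' k' c, 0 < g ∧ 0 < b' ∧ 0 < c ∧ Nat.Coprime k' b' ∧
      b = g * b' ∧ k = g * k' ∧ n = g * b' * c ∧ Nat.gcd k b = g := by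
    rintro b k ⟨c, rfl⟩
    have hb : 0 < b := Nat.pos_of_mul_pos_right hn
    obtain ⟨g, k', b', hg, hc, h1, h2⟩ := Nat.exists_coprime' (m := k) (n := b) (Nat.gcd_pos_of_pos_right _ hb)
    have h3 : Nat.gcd k b = g := by
      rw [h1, h2, Nat.gcd_mul_right, hc.gcd_eq_one, one_mul]
    subst h2
    exact ⟨g, b', k', c, hg, Nat.pos_of_mul_pos_right hb, Nat.pos_of_mul_pos_left hn, hc,
      mul_comm _ _, by rw [h1, mul_comm], by ring, h3⟩
  have key2 : ∀ g t, g ∣ n → ∃ b' k' c, 0 < g ∧ 0 < b' ∧ 0 < c ∧ Nat.Coprime k' b' ∧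
      t = k' * c ∧ n = g * b' * c ∧ Nat.gcd t (n / g) = c := by
    rintro g t ⟨N, rfl⟩
    have hg : 0 < g := Nat.pos_of_mul_pos_right hn
    have hN : 0 < N := Nat.pos_of_mul_pos_left hn
    obtain ⟨c, k', b', hc0, hc, h1, h2⟩ := Nat.exists_coprime' (m := t) (n := N) (Nat.gcd_pos_of_pos_right _ hN)
    refine ⟨b', k', c, hg, ?_, hc0, hc, h1, by rw [h2]; ring, ?_⟩
    · exact Nat.pos_of_mul_pos_right (h2 ▸ hN)
    · rw [Nat.mul_div_cancel_left _ hg, h1, h2, Nat.gcd_mul_right, hc.gcd_eq_one, one_mul]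
  have d1 : ∀ g b' c : ℕ, 0 < g → g * b' * c / g = b' * c := fun g b' c h => by
    rw [mul_assoc, Nat.mul_div_cancel_left _ h]
  have d2 : ∀ g b' c : ℕ, 0 < g → 0 < b' → g * b' * c / (g * b') = c := fun g b' c h h' => by
    rw [Nat.mul_div_cancel_left _ (Nat.mul_pos h h')]
  have d3 : ∀ g b' c : ℕ, 0 < c → g * b' * c / c = g * b' := fun g b' c h => by
    rw [Nat.mul_div_cancel _ h]
  refine sum_bij' (fun x _ => ⟨Nat.gcd x.2 x.1, x.2 / Nat.gcd x.2 x.1 * (n / x.1)⟩)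
    (fun y _ => ⟨n / Nat.gcd y.2 (n / y.1), y.1 * (y.2 / Nat.gcd y.2 (n / y.1))⟩) ?_ ?_ ?_ ?_ ?_
  · rintro ⟨b, k⟩ hx
    simp only [mem_sigma, Nat.mem_divisors, mem_range] at hx ⊢
    obtain ⟨g, b', k', c, hg, hb', hc, hcop, rfl, rfl, rfl, h⟩ := key1 b k hx.1.1
    rw [h, d1 _ _ _ hg, d2 _ _ _ hg hb', Nat.mul_div_cancel_left _ hg]
    refine ⟨⟨⟨b' * c, by ring⟩, hn.ne'⟩, ?_⟩
    have : g * k' < g * (a * b') := by linarith [hx.2, show a * (g * b') = g * (a * b') by ring]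
    have := Nat.lt_of_mul_lt_mul_left this
    rw [← mul_assoc]
    exact Nat.mul_lt_mul_of_pos_right this hc
  · rintro ⟨g, t⟩ hy
    simp only [mem_sigma, Nat.mem_divisors, mem_range] at hy ⊢
    obtain ⟨b', k', c, hg, hb', hc, hcop, rfl, rfl, h⟩ := key2 g t hy.1.1
    rw [h, d3 _ _ _ hc, Nat.mul_div_cancel _ hc]
    refine ⟨⟨⟨c, rfl⟩, hn.ne'⟩, ?_⟩
    have h2 := hy.2
    rw [d1 _ _ _ hg, ← mul_assoc] at h2
    have := Nat.lt_of_mul_lt_mul_right h2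
    calc g * k' < g * (a * b') := Nat.mul_lt_mul_of_pos_left this hg
      _ = _ := by ring
  · rintro ⟨b, k⟩ hx
    simp only [mem_sigma, Nat.mem_divisors, mem_range] at hx ⊢
    obtain ⟨g, b', k', c, hg, hb', hc, hcop, rfl, rfl, rfl, h⟩ := key1 b k hx.1.1
    have e : Nat.gcd (k' * c) (b' * c) = c := by
      rw [Nat.gcd_mul_right, hcop.gcd_eq_one, one_mul]
    simp only [h, d1 _ _ _ hg, d2 _ _ _ hg hb', Nat.mul_div_cancel_left _ hg, e, d3 _ _ _ hc,
      Nat.mul_div_cancel _ hc]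
  · rintro ⟨g, t⟩ hy
    simp only [mem_sigma, Nat.mem_divisors, mem_range] at hy ⊢
    obtain ⟨b', k', c, hg, hb', hc, hcop, rfl, rfl, h⟩ := key2 g t hy.1.1
    have e : Nat.gcd (g * k') (g * b') = g := by
      rw [Nat.gcd_mul_left, hcop.gcd_eq_one, mul_one]
    simp only [h, d2 _ _ _ hg hb', Nat.mul_div_cancel_left _ hg, e, d3 _ _ _ hc,
      Nat.mul_div_cancel _ hc]
  · rintro ⟨b, k⟩ hx
    rfl

/-- The generalized Petersson–Knopp identity for sums of Dedekind type with weight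
`(m_1, ..., m_d)`, i.e. each `f_j` is 1-periodic and satisfies
`Σ_{k mod a} f_j(x + k/a) = a^{m_j} f_j(ax)`. -/
theorem generalized_petersson_knopp (d : ℕ) (f : Fin d → ℝ → ℂ) (m : Fin d → ℤ)
    (hper : ∀ j x, f j (x + 1) = f j x)
    (hweight : ∀ j (a : ℕ), 0 < a → ∀ x : ℝ,
      ∑ k ∈ Finset.range a, f j (x + k / a) = (a : ℂ) ^ (m j) * f j (a * x))
    (n a : ℕ) (hn : 0 < n) (ha : 0 < a) (A : Fin d → ℕ) (hA : ∀ j, 0 < A j) :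
    (∑ b ∈ n.divisors, (b : ℂ) ^ (-(∑ j, m j)) *
        ∑ r ∈ Fintype.piFinset (fun _ : Fin d => Finset.range b),
          dedekindTypeSum f (a * b) (fun j => (n / b) * A j + r j * a)) =
      (n : ℂ) * (∑ b ∈ n.divisors, (b : ℂ) ^ ((d : ℤ) - 1 - ∑ j, m j)) *
        dedekindTypeSum f a A := by
  set M := ∑ j, m j with hM
  have ha' : (a : ℝ) ≠ 0 := by positivity
  let F : ℕ → ℂ := fun t => ∏ j, f j ((t : ℝ) * A j / a)
  have hF : ∀ t, F (t + a) = F t := by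
    intro t
    refine prod_congr rfl fun j _ => ?_
    rw [← (show Function.Periodic (f j) 1 from hper j).nat_mul (A j) ((t : ℝ) * A j / a)]
    congr 1
    push_cast
    field_simp
  have hL : ∀ b ∈ n.divisors, (b : ℂ) ^ (-M) *
        ∑ r ∈ Fintype.piFinset (fun _ : Fin d => Finset.range b),
          dedekindTypeSum f (a * b) (fun j => (n / b) * A j + r j * a) =
      ∑ k ∈ range (a * b), (fun (g t : ℕ) => (g : ℂ) ^ ((d : ℤ) - M) * F t)
        (Nat.gcd k b) (k / Nat.gcd k b * (n / b)) := by
    intro b hb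
    have hb0 : 0 < b := Nat.pos_of_mem_divisors hb
    unfold dedekindTypeSum
    rw [sum_comm, mul_sum]
    refine sum_congr rfl fun k _ => ?_
    rw [← prod_univ_sum (fun _ : Fin d => range b)
      (fun j r => f j ((k : ℝ) * ((n / b * A j + r * a : ℕ) : ℝ) / ((a * b : ℕ) : ℝ)))]
    generalize n / b = c
    obtain ⟨g, k', b', hg, hc, h1, h2⟩ :=
      Nat.exists_coprime' (m := k) (n := b) (Nat.gcd_pos_of_pos_right _ hb0)
    have h3 : Nat.gcd k b = g := by
      rw [h1, h2, Nat.gcd_mul_right, hc.gcd_eq_one, one_mul]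
    rw [h3]
    clear h3 hb
    rw [mul_comm] at h1 h2
    subst h1 h2
    have hb' : 0 < b' := Nat.pos_of_mul_pos_left hb0
    have hgr : (g : ℝ) ≠ 0 := by positivity
    have hbr : (b' : ℝ) ≠ 0 := by positivity
    have hgc : (g : ℂ) ≠ 0 := by exact_mod_cast hg.ne'
    have hbc : (b' : ℂ) ≠ 0 := by exact_mod_cast hb'.ne'
    have hj : ∀ j, ∑ r ∈ range (g * b'), f j (((g * k' : ℕ) : ℝ) *
        ((c * A j + r * a : ℕ) : ℝ) / ((a * (g * b') : ℕ) : ℝ)) =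
        g * ((b' : ℂ) ^ (m j) * f j (((k' * c : ℕ) : ℝ) * A j / a)) := by
      intro j
      have := pk_inner (f j) (m j) (hper j) (hweight j) g k' b' hg hb' hc
        ((k' : ℝ) * c * A j / (a * b'))
      have e : (b' : ℝ) * ((k' : ℝ) * c * A j / (a * b')) = ((k' * c : ℕ) : ℝ) * A j / a := by
        push_cast
        field_simp
      rw [e] at this
      rw [← this]
      refine sum_congr rfl fun r _ => ?_
      congr 1
      push_cast
      field_simp
    rw [prod_congr rfl fun j _ => hj j, prod_mul_distrib, prod_mul_distrib,
      Nat.mul_div_cancel_left _ hg]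
    have hz : ∏ j, (b' : ℂ) ^ (m j) = (b' : ℂ) ^ M := by
      rw [hM]
      generalize (univ : Finset (Fin d)) = s
      induction s using Finset.induction_on with
      | empty => simp
      | insert i s hi ih => rw [prod_insert hi, sum_insert hi, zpow_add₀ hbc, ih]
    rw [hz]
    simp only [prod_const, card_univ, Fintype.card_fin]
    change _ = (g : ℂ) ^ ((d : ℤ) - M) * F (k' * c)
    change _ * (_ * (_ * F (k' * c))) = _
    push_cast
    rw [mul_zpow, zpow_sub₀ hgc, zpow_neg, zpow_neg, zpow_natCast]
    have := zpow_ne_zero M hgc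
    have := zpow_ne_zero M hbc
    field_simp
  refine (sum_congr rfl hL).trans ((pk_biject (fun (g t : ℕ) => (g : ℂ) ^ ((d : ℤ) - M) * F t)
    n a hn).trans ?_)
  rw [mul_sum, sum_mul]
  refine sum_congr rfl fun g hg => ?_
  obtain ⟨N, rfl⟩ := Nat.dvd_of_mem_divisors hg
  have hg0 : 0 < g := Nat.pos_of_mem_divisors hg
  have hgc : (g : ℂ) ≠ 0 := by exact_mod_cast hg0.ne'
  rw [← mul_sum, Nat.mul_div_cancel_left _ hg0, mul_comm a N, pk_sum_periodic F a hF]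
  change _ * (_ * dedekindTypeSum f a A) = _
  have : (d : ℤ) - M = ((d : ℤ) - 1 - M) + 1 := by ring
  rw [this, zpow_add_one₀ hgc]
  push_cast
  ring
end

section
/- Let f: ℝ → ℂ satisfy f(x+1) = f(x) for all x and Σ_{k mod a} f(x + k/a) = a^m f(ax) for every positive integer a and all x, where m is a fixed integer. Then for all positive integers a, b and all real x, Σ_{k mod a} f(x + kb/a) = gcd(a,b)^{1−m} a^m f(ax/gcd(a,b)). -/
open Real Finset

theorem aux_sum_mul (h : ℕ → ℂ) (a : ℕ) (hp : ∀ n, h (n + a) = h n) (d : ℕ) :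
    ∑ k ∈ Finset.range (d * a), h k = (d : ℂ) * ∑ k ∈ Finset.range a, h k := by
  induction d with
  | zero => simp
  | succ d ih =>
    have hp2 : ∀ d n : ℕ, h (d * a + n) = h n := by
      intro d n
      induction d with
      | zero => simp
      | succ e ihe => rw [← ihe, ← hp (e * a + n)]; congr 1; ring
    rw [Nat.succ_mul, Finset.sum_range_add, ih]
    simp only [hp2]
    push_cast
    ring

theorem aux_sum_perm (g : ℕ → ℂ) (a b : ℕ) (ha : 0 < a) (hc : Nat.Coprime a b)
    (hp : ∀ n, g (n + a) = g n) :
    ∑ k ∈ Finset.range a, g (k * b) = ∑ k ∈ Finset.range a, g k := by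
  have hmod : ∀ n, g (n % a) = g n := fun n => Function.Periodic.map_mod_nat hp n
  have hm : Set.MapsTo (fun k => k * b % a) (Finset.range a : Set ℕ) (Finset.range a : Set ℕ) := by
    intro k _
    simpa using Nat.mod_lt _ ha
  have hi : Set.InjOn (fun k => k * b % a) (Finset.range a : Set ℕ) := by
    intro k hk l hl hkl
    have h1 : k * b ≡ l * b [MOD a] := hkl
    have h2 : k ≡ l [MOD a] := Nat.ModEq.cancel_right_of_coprime hc h1
    exact Nat.ModEq.eq_of_lt_of_lt h2 (by simpa using hk) (by simpa using hl)
  refine Finset.sum_nbij (fun k => k * b % a) (fun k hk => hm hk) hi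
    (Finset.surjOn_of_injOn_of_card_le _ hm hi le_rfl) ?_
  intro k _
  exact (hmod _).symm

/-- If `f : ℝ → ℂ` is 1-periodic and satisfies `Σ_{k mod a} f(x + k/a) = a^m f(ax)` for every
positive integer `a`, then `Σ_{k mod a} f(x + kb/a) = gcd(a,b)^{1−m} a^m f(ax/gcd(a,b))`. -/
theorem dedekind_type_shift (f : ℝ → ℂ) (m : ℤ)
    (hper : ∀ x, f (x + 1) = f x)
    (hweight : ∀ (a : ℕ), 0 < a → ∀ x : ℝ,
      ∑ k ∈ Finset.range a, f (x + k / a) = (a : ℂ) ^ m * f (a * x))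
    (a b : ℕ) (ha : 0 < a) (hb : 0 < b) (x : ℝ) :
    ∑ k ∈ Finset.range a, f (x + k * b / a) =
      (Nat.gcd a b : ℂ) ^ (1 - m) * (a : ℂ) ^ m * f (a * x / Nat.gcd a b) := by
  have hd : 0 < Nat.gcd a b := Nat.gcd_pos_of_pos_left b ha
  obtain ⟨a', b', hc, h1, h2⟩ := Nat.exists_coprime a b
  generalize Nat.gcd a b = d at *
  subst h1 h2
  have ha' : 0 < a' := Nat.pos_of_mul_pos_right ha
  have hdr : (d : ℝ) ≠ 0 := by positivity
  have har : (a' : ℝ) ≠ 0 := by positivity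
  have hdc : (d : ℂ) ≠ 0 := by exact_mod_cast hd.ne'
  have hg : ∀ n : ℕ, f (x + ((n + a' : ℕ) : ℝ) / a') = f (x + (n : ℝ) / a') := by
    intro n
    rw [← hper (x + (n : ℝ) / a')]
    congr 1
    push_cast
    field_simp
    try ring
  have hf : ∀ k : ℕ, f (x + k * ((b' * d : ℕ) : ℝ) / ((a' * d : ℕ) : ℝ))
      = f (x + ((k * b' : ℕ) : ℝ) / a') := by
    intro k
    congr 1
    push_cast
    field_simp
  have hgp : Function.Periodic (fun n : ℕ => f (x + (n : ℝ) / a')) a' := hg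
  simp only [hf]
  rw [mul_comm a' d, aux_sum_mul (fun k => f (x + ((k * b' : ℕ) : ℝ) / a')) a' ?_ d,
    aux_sum_perm (fun n => f (x + (n : ℝ) / a')) a' b' ha' hc hg, hweight a' ha' x]
  · have : ((d * a' : ℕ) : ℝ) * x / d = a' * x := by
      push_cast
      field_simp
    rw [this, zpow_sub₀ hdc, Nat.cast_mul, mul_zpow, zpow_one]
    have := zpow_ne_zero m hdc
    field_simp
  · intro n
    have := hgp.nat_mul b' (n * b')
    simp only [Nat.cast_id] at this
    rw [← this]
    congr 4
    ring
end
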